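/- Let a, b > 0 be real numbers which are linearly independent over the rationals. Then there exist a real sequence (λ_n)_{n≥1} such that λ_{n+1} − λ_n ∈ {a, b} for every n ≥ 1, and a nonnegative Schwartz function g on ℝ, such that for every p > 1 the system of translates {x ↦ g(x − λ_n)}_{n≥1} is complete in L^p(ℝ). -/

import Mathlib

open MeasureTheory ENNReal

/-- The system of translates `{x ↦ g (x - lam n)}_{n ≥ 1}` is complete in `L^p(ℝ)`:
its closed linear span is all of (complex-valued) `L^p(ℝ)`. -/
def TranslatesComplete (g : ℝ → ℝ) (lam : ℕ → ℝ) (p : ℝ≥0∞) [Fact (1 ≤ p)] : Prop :=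
  Dense (↑(Submodule.span ℂ
      {F : Lp ℂ p (volume : Measure ℝ) |
        ∃ n : ℕ, 1 ≤ n ∧ ⇑F =ᵐ[volume] fun x => (g (x - lam n) : ℂ)}) :
    Set (Lp ℂ p (volume : Measure ℝ)))

section
open Filter Topology

namespace FLC

/-- complex Schwartz space on the line -/
abbrev E := SchwartzMap ℝ ℂ

/-- translation by `s` -/
noncomputable abbrev T (s : ℝ) : E →L[ℂ] E := SchwartzMap.compSubConstCLM ℂ s

/-- multiplication by a function of temperate growth -/
noncomputable abbrev M (v : ℝ → ℂ) : E →L[ℂ] E := SchwartzMap.smulLeftCLM ℂ v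

noncomputable abbrev sn (k n : ℕ) : Seminorm ℂ E := SchwartzMap.seminorm ℂ k n

lemma M_apply {v : ℝ → ℂ} (hv : v.HasTemperateGrowth) (A : E) (x : ℝ) : M v A x = v x * A x :=
  SchwartzMap.smulLeftCLM_apply_apply hv A x

lemma sn_succ_le (k n : ℕ) (f : E) :
    sn k (n+1) f ≤ sn k n (SchwartzMap.derivCLM ℂ ℂ f) := by
  apply SchwartzMap.seminorm_le_bound' _ _ _ _ (apply_nonneg _ _)
  intro x
  rw [iteratedDeriv_succ']
  exact SchwartzMap.le_seminorm' ℂ k n (SchwartzMap.derivCLM ℂ ℂ f) x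

lemma pow_tendsto (v v' : ℝ → ℂ) (hv : v.HasTemperateGrowth) (hv' : v'.HasTemperateGrowth)
    (hd : ∀ x, HasDerivAt v (v' x) x) (ρ : ℝ) (hρ0 : 0 ≤ ρ) (hρ : ρ < 1) (n : ℕ) :
    ∀ (A : E), (∀ x ∈ tsupport A, ‖v x‖ ≤ ρ) → ∀ k j : ℕ,
    Tendsto (fun K : ℕ => ((K:ℝ)+1)^j * sn k n (M (fun x => v x ^ K) A)) atTop (𝓝 0) := by
  have hvp : ∀ K : ℕ, (fun x => v x ^ K).HasTemperateGrowth := fun K => hv.pow K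
  induction n with
  | zero =>
    intro A hA k j
    have h1 : ∀ K : ℕ, sn k 0 (M (fun x => v x ^ K) A) ≤ ρ^K * sn k 0 A := by
      intro K
      apply SchwartzMap.seminorm_le_bound' _ _ _ _ (by positivity)
      intro x
      rw [iteratedDeriv_zero, M_apply (hvp K)]
      by_cases hx : x ∈ tsupport A
      · have h2 := SchwartzMap.le_seminorm' ℂ k 0 A x
        rw [iteratedDeriv_zero] at h2
        have h3 : ‖v x‖^K ≤ ρ^K := pow_le_pow_left₀ (norm_nonneg _) (hA x hx) K
        rw [norm_mul, norm_pow]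
        calc |x|^k * (‖v x‖^K * ‖A x‖) = ‖v x‖^K * (|x|^k * ‖A x‖) := by ring
          _ ≤ ρ^K * sn k 0 A := by gcongr
      · rw [image_eq_zero_of_notMem_tsupport hx]
        simp only [norm_zero, mul_zero]; positivity
    have h0 : Tendsto (fun K : ℕ => ((K:ℝ)+1)^j * ρ^K) atTop (𝓝 0) := by
      rcases hρ0.eq_or_lt with h | h
      · refine tendsto_const_nhds.congr' ?_
        filter_upwards [eventually_gt_atTop 0] with K hK
        rw [← h, zero_pow hK.ne', mul_zero]
      · have := (tendsto_pow_const_mul_const_pow_of_lt_one j hρ0 hρ).comp (tendsto_add_atTop_nat 1)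
        have h2 := this.const_mul (ρ⁻¹)
        rw [mul_zero] at h2
        refine h2.congr ?_
        intro K
        simp only [Function.comp, pow_succ]
        push_cast
        field_simp
    have h4 := h0.mul_const (sn k 0 A)
    rw [zero_mul] at h4
    refine squeeze_zero (fun K => by positivity) (fun K => ?_) h4
    rw [mul_assoc]
    gcongr
    exact h1 K
  | succ n ih =>
    intro A hA k j
    rw [← tendsto_add_atTop_iff_nat 1]
    set A' := SchwartzMap.derivCLM ℂ ℂ A with hA'
    have hA's : ∀ x ∈ tsupport A', ‖v x‖ ≤ ρ := fun x hx =>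
      hA x (SchwartzMap.tsupport_derivCLM_subset ℂ A hx)
    set B := M v' A with hB
    have hBs : ∀ x ∈ tsupport B, ‖v x‖ ≤ ρ := fun x hx => by
      refine hA x (closure_mono ?_ hx)
      intro y hy hy'
      apply hy
      rw [hB, M_apply hv', hy', mul_zero]
    have t1 := ((ih A' hA's k j).comp (tendsto_add_atTop_nat 1))
    have t2 := (ih B hBs k (j+1)).const_mul (2^j : ℝ)
    have t3 := t1.add t2
    rw [mul_zero, add_zero] at t3
    refine squeeze_zero (fun K => by positivity) (fun K => ?_) t3
    have e : SchwartzMap.derivCLM ℂ ℂ (M (fun x => v x ^ (K+1)) A)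
        = M (fun x => v x ^ (K+1)) A' + ((K+1 : ℕ) : ℂ) • M (fun x => v x ^ K) B := by
      ext x
      have e1 : (M (fun x => v x ^ (K+1)) A : ℝ → ℂ) = fun x => v x ^ (K+1) * A x := by
        ext y; rw [M_apply (hvp _)]
      rw [SchwartzMap.derivCLM_apply, e1]
      have := ((hd x).pow (K+1)).mul (A.hasDerivAt x)
      have h5 := this.deriv
      have : deriv (fun x => v x ^ (K+1) * A x) x = _ := h5
      rw [this]
      change _ = M (fun x => v x ^ (K+1)) A' x + ((K+1 : ℕ) : ℂ) * M (fun x => v x ^ K) B x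
      rw [M_apply (hvp _), M_apply (hvp _), hB, M_apply hv', hA', SchwartzMap.derivCLM_apply]
      simp
      ring
    have h6 : sn k (n+1) (M (fun x => v x ^ (K+1)) A) ≤ sn k n (M (fun x => v x ^ (K+1)) A')
        + ((K:ℝ)+1) * sn k n (M (fun x => v x ^ K) B) := by
      refine (sn_succ_le k n _).trans ?_
      rw [e]
      refine (map_add_le_add _ _ _).trans ?_
      rw [map_smul_eq_mul, Complex.norm_natCast]
      push_cast
      exact le_rfl
    simp only [Function.comp]
    push_cast
    have h7 : ((K:ℝ)+1+1)^j ≤ 2^j * ((K:ℝ)+1)^j := by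
      rw [← mul_pow]; gcongr
      linarith [(Nat.cast_nonneg K : (0:ℝ) ≤ K)]
    calc ((K:ℝ)+1+1)^j * sn k (n+1) (M (fun x => v x ^ (K+1)) A)
        ≤ ((K:ℝ)+1+1)^j * (sn k n (M (fun x => v x ^ (K+1)) A')
        + ((K:ℝ)+1) * sn k n (M (fun x => v x ^ K) B)) := by gcongr
      _ = ((K:ℝ)+1+1)^j * sn k n (M (fun x => v x ^ (K+1)) A') +
          ((K:ℝ)+1+1)^j * (((K:ℝ)+1) * sn k n (M (fun x => v x ^ K) B)) := by ring
      _ ≤ ((K:ℝ)+1+1)^j * sn k n (M (fun x => v x ^ (K+1)) A') +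
          (2^j * ((K:ℝ)+1)^j) * (((K:ℝ)+1) * sn k n (M (fun x => v x ^ K) B)) := by gcongr
      _ = _ := by ring

lemma tendsto_zero_of_sn {f : ℕ → E} (h : ∀ k n, Tendsto (fun K => sn k n (f K)) atTop (𝓝 0)) :
    Tendsto f atTop (𝓝 0) := by
  rw [(schwartz_withSeminorms ℂ ℝ ℂ).tendsto_nhds]
  rintro ⟨k, n⟩ ε hε
  have := (h k n).eventually (gt_mem_nhds hε)
  filter_upwards [this] with K hK
  simpa using! hK

lemma pow_tendsto' (v v' : ℝ → ℂ) (hv : v.HasTemperateGrowth) (hv' : v'.HasTemperateGrowth)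
    (hd : ∀ x, HasDerivAt v (v' x) x) (ρ : ℝ) (hρ0 : 0 ≤ ρ) (hρ : ρ < 1)
    (A : E) (hA : ∀ x ∈ tsupport A, ‖v x‖ ≤ ρ) :
    Tendsto (fun K : ℕ => M (fun x => v x ^ K) A) atTop (𝓝 0) := by
  apply tendsto_zero_of_sn
  intro k n
  simpa using pow_tendsto v v' hv hv' hd ρ hρ0 hρ n A hA k 0

/-- the character -/
noncomputable def ch (s : ℝ) (x : ℝ) : ℂ := Complex.exp ((-(2 * Real.pi * s * Complex.I)) * x)

lemma ch_hasDerivAt (s x : ℝ) : HasDerivAt (ch s) (-(2 * Real.pi * s * Complex.I) * ch s x) x := by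
  have h : HasDerivAt (fun y : ℝ => (-(2 * Real.pi * s * Complex.I)) * (y:ℂ))
      (-(2 * Real.pi * s * Complex.I)) x := by
    simpa using (Complex.ofRealCLM.hasDerivAt (x := x)).const_mul (-(2 * Real.pi * s * Complex.I))
  have := h.cexp
  rw [mul_comm (-(2 * Real.pi * s * Complex.I)) (ch s x)]
  exact this

lemma ch_norm (s x : ℝ) : ‖ch s x‖ = 1 := by
  rw [ch, Complex.norm_exp]; simp

lemma ch_re (s x : ℝ) : (ch s x).re = Real.cos (2 * Real.pi * s * x) := by
  rw [ch]
  have : (-(2 * Real.pi * s * Complex.I)) * (x:ℂ) = ((-(2 * Real.pi * s * x) : ℝ) : ℂ) * Complex.I := by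
    push_cast; ring
  rw [this, Complex.exp_ofReal_mul_I_re, Real.cos_neg]

lemma ch_iter (s : ℝ) (n : ℕ) :
    iteratedDeriv n (ch s) = fun x => (-(2 * Real.pi * s * Complex.I))^n * ch s x := by
  induction n with
  | zero => simp
  | succ n ih =>
    rw [iteratedDeriv_succ, ih]
    ext x
    rw [((ch_hasDerivAt s x).const_mul _).deriv]
    ring

lemma ch_contDiff (s : ℝ) : ContDiff ℝ ((⊤ : ℕ∞) : WithTop ℕ∞) (ch s) := by
  unfold ch
  exact (contDiff_const.mul Complex.ofRealCLM.contDiff).cexp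

lemma ch_temperate (s : ℝ) : (ch s).HasTemperateGrowth := by
  refine ⟨ch_contDiff s, fun n => ⟨0, ‖(-(2 * Real.pi * s * Complex.I) : ℂ)‖^n, fun x => ?_⟩⟩
  rw [norm_iteratedFDeriv_eq_norm_iteratedDeriv, ch_iter]
  simp only [norm_mul, norm_pow, ch_norm, pow_zero]
  exact le_rfl

lemma fourier_T (s : ℝ) (f : E) : FourierTransform.fourier (T s f) = M (ch s) (FourierTransform.fourier f) := by
  ext x
  rw [SchwartzMap.smulLeftCLM_apply_apply (ch_temperate s), SchwartzMap.fourier_coe,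
    SchwartzMap.fourier_coe, Real.fourier_real_eq_integral_exp_smul,
    Real.fourier_real_eq_integral_exp_smul]
  rw [← integral_add_right_eq_self _ s, smul_eq_mul, ← integral_const_mul]
  congr 1
  ext y
  simp only [SchwartzMap.compSubConstCLM_apply, add_sub_cancel_right, smul_eq_mul, ch]
  rw [← mul_assoc, ← Complex.exp_add]
  congr 2
  push_cast; ring

lemma T_add (s t : ℝ) (f : E) : T s (T t f) = T (s + t) f := by
  rw [SchwartzMap.compSubConstCLM_comp, add_comm]

end FLC
end

section
open Filter Topology

namespace FLC

lemma poly_exists (δ : ℝ) (h0 : 0 < δ) (h1 : δ < 1/2) :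
    ∃ Q : Polynomial ℂ, Q.eval 0 = 1 ∧ ∃ ρ : ℝ, 0 ≤ ρ ∧ ρ < 1 ∧
      ∀ w : ℂ, ‖w‖ = 1 → -1 + 2*δ ≤ w.re → ‖Q.eval w‖ ≤ ρ := by
  set r : ℝ := 1 - δ with hr
  obtain ⟨N, hN⟩ := exists_pow_lt_of_lt_one (show 0 < δ^2/16 by positivity) (show r < 1 by linarith)
  set c : ℝ := δ^3/256 with hc
  let R : Polynomial ℂ := Polynomial.C (2*r : ℂ) * Polynomial.X *
    ∑ n ∈ Finset.range N, (-(Polynomial.C (r:ℂ) * Polynomial.X))^n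
  have hd3 : δ^3 ≤ 1 := pow_le_one₀ h0.le (by linarith)
  have hd4 : δ^4 ≤ 1 := pow_le_one₀ h0.le (by linarith)
  refine ⟨1 - Polynomial.C (c:ℂ) * R, ?_, Real.sqrt (1 - δ^4/2048), Real.sqrt_nonneg _, ?_, ?_⟩
  · simp [R]
  · rw [Real.sqrt_lt' one_pos]
    have : 0 < δ^4 := by positivity
    linarith
  intro w hw hre
  apply Real.le_sqrt_of_sq_le
  have hev : (1 - Polynomial.C (c:ℂ) * R).eval w = 1 - c * R.eval w := by simp
  rw [hev]
  set z : ℂ := -(r * w) with hz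
  have hRe : R.eval w = -2 * z * ∑ n ∈ Finset.range N, z^n := by
    simp only [R, Polynomial.eval_mul, Polynomial.eval_C, Polynomial.eval_X,
      Polynomial.eval_finsetSum, Polynomial.eval_pow, Polynomial.eval_neg, hz]
    ring
  have hr1 : 1/2 ≤ r := by rw [hr]; linarith
  have hzn : ‖z‖ = r := by
    rw [hz, norm_neg, norm_mul, hw, mul_one, Complex.norm_real, Real.norm_eq_abs, abs_of_nonneg (by linarith)]
  have hz1 : δ ≤ ‖1 - z‖ := by
    have := norm_sub_norm_le (1:ℂ) z
    rw [norm_one, hzn] at this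
    linarith
  have hzne : 1 - z ≠ 0 := by
    intro h; rw [h, norm_zero] at hz1; linarith
  have hgeo : ∑ n ∈ Finset.range N, z^n = (1 - z^N)/(1 - z) := by
    rw [eq_div_iff hzne, mul_comm]; exact mul_neg_geom_sum z N
  set q : ℂ := -2*z/(1-z) with hq
  have hR2 : R.eval w = q - q * z^N := by
    rw [hRe, hgeo, hq]; field_simp; ring
  have hqn : ‖q‖ ≤ 2/δ := by
    rw [hq, norm_div, norm_mul, hzn]
    simp only [norm_neg, Complex.norm_ofNat]
    gcongr
    · linarith
  have hzN : ‖q * z^N‖ ≤ δ/8 := by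
    rw [norm_mul, norm_pow, hzn]
    calc ‖q‖ * r^N ≤ 2/δ * (δ^2/16) := by gcongr
      _ = δ/8 := by field_simp; ring
  have hqre : δ/4 ≤ q.re := by
    have hns : Complex.normSq (1 - z) ≤ 4 := by
      rw [Complex.normSq_eq_norm_sq]
      have : ‖1 - z‖ ≤ 2 := by
        refine (norm_sub_le _ _).trans ?_
        rw [norm_one, hzn]; linarith
      nlinarith [norm_nonneg (1 - z)]
    have hns0 : 0 < Complex.normSq (1 - z) := Complex.normSq_pos.mpr hzne
    have hwsq : w.re^2 + w.im^2 = 1 := by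
      have := Complex.sq_norm w
      rw [hw, Complex.normSq_apply] at this
      nlinarith
    have : q.re = 2 * r * (w.re + r) / Complex.normSq (1 - z) := by
      rw [hq, Complex.div_re, ← add_div]
      congr 1
      simp only [hz]
      simp
      linear_combination 2 * r^2 * hwsq
    rw [this, le_div_iff₀ hns0]
    have h5 : δ ≤ w.re + r := by rw [hr]; linarith
    calc δ/4 * Complex.normSq (1 - z) ≤ δ/4*4 := by gcongr
      _ = 2 * (1/2) * δ := by ring
      _ ≤ 2 * r * (w.re + r) := by gcongr
  have hRre : δ/8 ≤ (R.eval w).re := by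
    rw [hR2, Complex.sub_re]
    have := (Complex.abs_re_le_norm (q*z^N)).trans hzN
    have := (le_abs_self _).trans this
    linarith
  have hRn : ‖R.eval w‖ ≤ 4/δ := by
    rw [hR2]
    refine (norm_sub_le _ _).trans ?_
    have : δ/8 ≤ 2/δ := by
      rw [div_le_div_iff₀ (by norm_num) h0]; nlinarith
    calc _ ≤ 2/δ + 2/δ := by linarith
      _ = 4/δ := by ring
  have hsq : ‖1 - (c:ℂ) * R.eval w‖^2 = 1 - 2*c*(R.eval w).re + c^2 * ‖R.eval w‖^2 := by
    rw [Complex.sq_norm, Complex.sq_norm, Complex.normSq_apply, Complex.normSq_apply]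
    simp
    ring
  rw [hsq]
  have hc0 : 0 ≤ c := by positivity
  have e1 : c^2 * ‖R.eval w‖^2 ≤ c^2 * (4/δ)^2 := by gcongr
  have e2 : 2*c*(δ/8) ≤ 2*c*(R.eval w).re := by gcongr
  have e3 : c^2 * (4/δ)^2 = δ^4/4096 := by rw [hc]; field_simp; ring
  have e4 : 2*c*(δ/8) = δ^4/1024 := by rw [hc]; ring
  have : 0 < δ^4 := by positivity
  linarith

lemma poly_temperate (a : ℝ) (Q : Polynomial ℂ) :
    (fun x => Q.eval (ch a x)).HasTemperateGrowth := by
  induction Q using Polynomial.induction_on' with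
  | add p q hp hq => simp only [Polynomial.eval_add]; exact hp.add hq
  | monomial n c =>
    simp only [Polynomial.eval_monomial]
    exact (Function.HasTemperateGrowth.const c).mul ((ch_temperate a).pow n)

lemma fourier_poly (a : ℝ) (Q : Polynomial ℂ) (f : E) :
    FourierTransform.fourier (Polynomial.aeval (T a) Q f)
      = M (fun x => Q.eval (ch a x)) (FourierTransform.fourier f) := by
  ext x
  rw [M_apply (poly_temperate a Q)]
  induction Q using Polynomial.induction_on' with
  | add p q hp hq =>
    simp only [map_add, add_apply, Polynomial.eval_add, FourierTransform.fourier_add, add_mul]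
    rw [← hp, ← hq]
  | monomial n c =>
    rw [Polynomial.aeval_monomial, Polynomial.eval_monomial]
    have : ∀ n : ℕ, FourierTransform.fourier ((T a ^ n) f) x = ch a x ^ n * FourierTransform.fourier f x := by
      intro n
      induction n with
      | zero => simp
      | succ n ih =>
        rw [pow_succ', mul_apply_eq_comp, fourier_T, M_apply (ch_temperate a), ih]; ring
    have e : (algebraMap ℂ (E →L[ℂ] E) c * T a ^ n) f = c • ((T a ^ n) f) := by
      rw [Algebra.algebraMap_eq_smul_one, smul_mul_assoc, one_mul]; rfl
    rw [e, FourierTransform.fourier_smul, mul_assoc, ← this]; rfl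

lemma core (a : ℝ) (H : E) (hc : HasCompactSupport (FourierTransform.fourier H))
    (hZ : ∀ x ∈ tsupport (FourierTransform.fourier H), Real.cos (2 * Real.pi * a * x) ≠ -1) :
    ∃ Q : Polynomial ℂ, Q.eval 0 = 1 ∧
      Tendsto (fun n : ℕ => Polynomial.aeval (T a) (Q^n) H) atTop (𝓝 0) := by
  obtain ⟨δ, hδ0, hδ1, hδ⟩ : ∃ δ : ℝ, 0 < δ ∧ δ < 1/2 ∧ ∀ x ∈ tsupport (FourierTransform.fourier H),
      -1 + 2*δ ≤ Real.cos (2 * Real.pi * a * x) := by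
    have hcont : ContinuousOn (fun x => Real.cos (2 * Real.pi * a * x)) (tsupport (FourierTransform.fourier H)) := by
      fun_prop
    rcases (tsupport (FourierTransform.fourier H)).eq_empty_or_nonempty with h | h
    · exact ⟨1/4, by norm_num, by norm_num, by simp [h]⟩
    obtain ⟨x0, hx0, hm⟩ := IsCompact.exists_isMinOn hc h hcont
    have h1 : -1 < Real.cos (2 * Real.pi * a * x0) :=
      lt_of_le_of_ne (Real.neg_one_le_cos _) (hZ x0 hx0).symm
    refine ⟨min (1/4) ((Real.cos (2 * Real.pi * a * x0) + 1)/2), lt_min (by norm_num) (by linarith),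
      (min_le_left _ _).trans_lt (by norm_num), fun x hx => ?_⟩
    have h2 : Real.cos (2 * Real.pi * a * x0) ≤ Real.cos (2 * Real.pi * a * x) := hm hx
    linarith [min_le_right (1/4) ((Real.cos (2 * Real.pi * a * x0) + 1)/2)]
  obtain ⟨Q, hQ0, ρ, hρ0, hρ1, hQ⟩ := poly_exists δ hδ0 hδ1
  refine ⟨Q, hQ0, ?_⟩
  have key := pow_tendsto' (fun x => Q.eval (ch a x))
    (fun x => Q.derivative.eval (ch a x) * (-(2 * Real.pi * a * Complex.I) * ch a x))
    (poly_temperate a Q)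
    ((poly_temperate a _).mul ((Function.HasTemperateGrowth.const _).mul (ch_temperate a)))
    (fun x => (Q.hasDerivAt (ch a x)).comp x (ch_hasDerivAt a x)) ρ hρ0 hρ1
    (FourierTransform.fourier H) (fun x hx => hQ _ (ch_norm a x) (by rw [ch_re]; exact hδ x hx))
  have h3 := ((FourierTransform.fourierInvCLM ℂ E).continuous.tendsto 0).comp key
  rw [map_zero] at h3
  refine h3.congr fun n => ?_
  have := fourier_poly a (Q^n) H
  simp only [Polynomial.eval_pow] at this
  simp only [Function.comp, ← this]
  simp

end FLC
end

section
open Filter Topology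
open scoped FourierTransform ComplexOrder

namespace FLC

lemma base_bump (r : ℝ) (hr : 0 < r) : ∃ V : E, (∀ x, 0 ≤ V x) ∧ (0 < V 0) ∧
    (∀ x, r < |x| → V x = 0) ∧ (∀ x, 0 ≤ 𝓕 V x) := by
  let φ : ContDiffBump (0:ℝ) := ⟨r/4, r/2, by linarith, by linarith⟩
  have hφc : HasCompactSupport (fun x => (φ x : ℂ)) := by
    refine φ.hasCompactSupport.comp_left (g := fun y : ℝ => (y:ℂ)) (by simp)
  have hφs : ContDiff ℝ ((⊤ : ℕ∞) : WithTop ℕ∞) (fun x => (φ x : ℂ)) :=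
    Complex.ofRealCLM.contDiff.comp φ.contDiff
  let B : E := hφc.toSchwartzMap hφs
  have hB : ∀ x, B x = (φ x : ℂ) := fun x => rfl
  let V : E := SchwartzMap.convolution (ContinuousLinearMap.mul ℂ ℂ) B B
  have hV : ∀ x, V x = ((∫ t, φ t * φ (x - t) : ℝ) : ℂ) := by
    intro x
    rw [SchwartzMap.convolution_apply]
    simp only [convolution, ContinuousLinearMap.mul_apply', hB]
    rw [← integral_complex_ofReal]
    simp
  have hBreal : ∀ x, (starRingEnd ℂ) (𝓕 B x) = 𝓕 B x := by
    intro x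
    rw [SchwartzMap.fourier_coe, Real.fourier_real_eq_integral_exp_smul, ← integral_conj,
      ← integral_neg_eq_self]
    congr 1
    ext y
    simp only [smul_eq_mul, map_mul, hB, φ.neg, Complex.conj_ofReal, ← Complex.exp_conj]
    simp
  refine ⟨V, fun x => ?_, ?_, fun x hx => ?_, fun x => ?_⟩
  · rw [hV]
    exact Complex.zero_le_real.mpr (integral_nonneg fun t => mul_nonneg φ.nonneg φ.nonneg)
  · rw [hV]
    refine Complex.zero_lt_real.mpr ?_
    simp only [zero_sub, φ.neg]
    apply Continuous.integral_pos_of_hasCompactSupport_nonneg_nonzero (x := 0)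
    · exact φ.continuous.mul φ.continuous
    · exact φ.hasCompactSupport.mul_left
    · exact fun t => mul_nonneg φ.nonneg φ.nonneg
    · have := φ.pos_of_mem_ball (x := 0) (Metric.mem_ball_self φ.rOut_pos)
      positivity
  · rw [hV]
    rw [show (fun t => φ t * φ (x - t)) = fun _ => 0 from ?_]
    · simp
    ext t
    by_cases h : r/2 ≤ |t|
    · rw [φ.zero_of_le_dist (x := t) (by simpa using h), zero_mul]
    · rw [φ.zero_of_le_dist (x := x - t), mul_zero]
      simp only [dist_zero_right, Real.norm_eq_abs]
      have := abs_sub_abs_le_abs_sub x t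
      change r/2 ≤ _
      linarith
  · rw [SchwartzMap.fourier_convolution, SchwartzMap.pairing_apply_apply]
    simp only [ContinuousLinearMap.mul_apply']
    have h := hBreal x
    rw [Complex.conj_eq_iff_real] at h
    obtain ⟨q, hq⟩ := h
    rw [hq, ← Complex.ofReal_mul]
    exact Complex.zero_le_real.mpr (mul_self_nonneg q)

lemma block (O : Set ℝ) (hO : IsOpen O) (h0 : (0:ℝ) ∈ O) (hs : ∀ x ∈ O, -x ∈ O) (z : ℝ) (hz : z ∈ O) :
    ∃ G : E, (∀ x, 0 ≤ G x) ∧ (∀ x, 0 ≤ 𝓕 G x) ∧ HasCompactSupport (𝓕 G : E) ∧ tsupport (𝓕 G : E) ⊆ O ∧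
      0 < 𝓕 G z := by
  obtain ⟨r, hr, hr0, hr1, hr2⟩ : ∃ r > 0, Metric.closedBall 0 r ⊆ O ∧ Metric.closedBall z r ⊆ O ∧
      Metric.closedBall (-z) r ⊆ O := by
    have e0 := (Metric.nhds_basis_closedBall.mem_iff).1 (hO.mem_nhds h0)
    have e1 := (Metric.nhds_basis_closedBall.mem_iff).1 (hO.mem_nhds hz)
    have e2 := (Metric.nhds_basis_closedBall.mem_iff).1 (hO.mem_nhds (hs z hz))
    obtain ⟨r0, h0, e0⟩ := e0
    obtain ⟨r1, h1, e1⟩ := e1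
    obtain ⟨r2, h2, e2⟩ := e2
    refine ⟨min r0 (min r1 r2), by positivity, (Metric.closedBall_subset_closedBall ?_).trans e0,
      (Metric.closedBall_subset_closedBall ?_).trans e1, (Metric.closedBall_subset_closedBall ?_).trans e2⟩
    · simp
    · simp
    · simp
  obtain ⟨V, hV0, hVp, hVs, hVF⟩ := base_bump r hr
  let W : E := V + (1/2 : ℂ) • (T z V + T (-z) V)
  have hW : ∀ x, W x = V x + 1/2 * (V (x - z) + V (x + z)) := by
    intro x
    change V x + 1/2 * (T z V x + T (-z) V x) = _
    simp
  have hFW : ∀ x, 𝓕 W x = ((1 + Real.cos (2 * Real.pi * z * x) : ℝ) : ℂ) * 𝓕 V x := by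
    intro x
    have : 𝓕 W = 𝓕 V + (1/2 : ℂ) • (𝓕 (T z V) + 𝓕 (T (-z) V)) := by
      rw [FourierTransform.fourier_add, FourierTransform.fourier_smul, FourierTransform.fourier_add]
    rw [this, fourier_T, fourier_T]
    change 𝓕 V x + 1/2 * (M (ch z) (𝓕 V) x + M (ch (-z)) (𝓕 V) x) = _
    rw [M_apply (ch_temperate _), M_apply (ch_temperate _)]
    rw [Complex.ofReal_add, Complex.ofReal_cos, Complex.cos]
    unfold ch
    push_cast
    ring_nf
  have hsup : Function.support W ⊆ Metric.closedBall 0 r ∪ Metric.closedBall z r ∪ Metric.closedBall (-z) r := by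
    intro x hx
    by_contra hcon
    simp only [Set.mem_union, Metric.mem_closedBall, Real.dist_eq, not_or, not_le, sub_zero,
      sub_neg_eq_add] at hcon
    apply hx
    rw [hW, hVs _ hcon.1.1, hVs _ hcon.1.2, hVs _ hcon.2]; simp
  have hcomp : IsCompact (Metric.closedBall 0 r ∪ Metric.closedBall z r ∪ Metric.closedBall (-z) r) :=
    ((isCompact_closedBall _ _).union (isCompact_closedBall _ _)).union (isCompact_closedBall _ _)
  have hts : tsupport W ⊆ Metric.closedBall 0 r ∪ Metric.closedBall z r ∪ Metric.closedBall (-z) r :=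
    closure_minimal hsup hcomp.isClosed
  have hFG : 𝓕 (𝓕⁻ W) = W := by simp
  refine ⟨𝓕⁻ W, fun x => ?_, ?_, ?_, ?_, ?_⟩
  · have : 𝓕⁻ W x = 𝓕 W (-x) := by
      rw [SchwartzMap.fourier_coe, SchwartzMap.fourierInv_coe, Real.fourierInv_eq_fourier_neg]
    rw [this, hFW]
    refine mul_nonneg (Complex.zero_le_real.mpr ?_) (hVF _)
    linarith [Real.neg_one_le_cos (2 * Real.pi * z * -x)]
  · rw [hFG]
    intro x
    rw [hW]
    have : (0:ℂ) ≤ 1/2 := by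
      have := Complex.zero_le_real.mpr (show (0:ℝ) ≤ 1/2 by norm_num)
      simp
    exact add_nonneg (hV0 _) (mul_nonneg this (add_nonneg (hV0 _) (hV0 _)))
  · rw [hFG]
    exact hcomp.of_isClosed_subset (isClosed_tsupport _) hts
  · rw [hFG]
    exact hts.trans (Set.union_subset (Set.union_subset hr0 hr1) hr2)
  · rw [hFG, hW, sub_self]
    have : (0:ℂ) < 1/2 := by
      have := Complex.zero_lt_real.mpr (show (0:ℝ) < 1/2 by norm_num)
      simp
    exact add_pos_of_nonneg_of_pos (hV0 _) (mul_pos this (add_pos_of_pos_of_nonneg hVp (hV0 _)))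

/-- countable family of blocks -/
lemma blocks (O : Set ℝ) (hO : IsOpen O) (h0 : (0:ℝ) ∈ O) (hs : ∀ x ∈ O, -x ∈ O) :
    ∃ G : ℕ → E, (∀ j x, 0 ≤ G j x) ∧ (∀ j x, 0 ≤ 𝓕 (G j) x) ∧ (∀ j, HasCompactSupport (𝓕 (G j) : E)) ∧
      (∀ j, tsupport (𝓕 (G j) : E) ⊆ O) ∧ ∀ z ∈ O, ∃ j, 0 < 𝓕 (G j) z := by
  have := fun z : O => block O hO h0 hs z z.2
  choose G h1 h2 h3 h4 h5 using this
  let U : O → Set O := fun z => {x | 𝓕 (G z) x ≠ 0}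
  have hU : ∀ z, IsOpen (U z) := fun z =>
    isOpen_ne_fun ((SchwartzMap.continuous _).comp continuous_subtype_val) continuous_const
  obtain ⟨S, hS, hS'⟩ := TopologicalSpace.isOpen_iUnion_countable U hU
  have hSne : S.Nonempty := by
    by_contra h
    rw [Set.not_nonempty_iff_eq_empty] at h
    subst h
    have : (⟨0, h0⟩ : O) ∈ ⋃ z, U z := Set.mem_iUnion.2 ⟨⟨0, h0⟩, (h5 _).ne'⟩
    rw [← hS'] at this
    simp at this
  obtain ⟨e, he⟩ := hS.exists_eq_range hSne
  refine ⟨fun j => G (e j), fun j => h1 _, fun j => h2 _, fun j => h3 _, fun j => h4 _, fun z hz => ?_⟩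
  have : (⟨z, hz⟩ : O) ∈ ⋃ z, U z := Set.mem_iUnion.2 ⟨⟨z, hz⟩, (h5 _).ne'⟩
  rw [← hS'] at this
  simp only [Set.mem_iUnion] at this
  obtain ⟨i, hi, hz'⟩ := this
  rw [he] at hi
  obtain ⟨j, rfl⟩ := hi
  exact ⟨j, lt_of_le_of_ne (h2 _ _) (Ne.symm hz')⟩

end FLC
end

section
open Filter Topology
open scoped FourierTransform ComplexOrder

namespace FLC

lemma sn_bound (n : ℕ) (f : E) (x : ℝ) : ‖iteratedFDeriv ℝ n f x‖ ≤ sn 0 n f := by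
  simpa using! SchwartzMap.le_seminorm ℂ 0 n f x

lemma exists_sum (f : ℕ → E) (hf : ∀ k n, Summable (fun j => sn k n (f j))) :
    ∃ S : E, (∀ x, S x = ∑' j, f j x) ∧ ∀ k n, sn k n S ≤ ∑' j, sn k n (f j) := by
  have h1 : ∀ i, ContDiff ℝ ((⊤ : ℕ∞) : WithTop ℕ∞) (f i) := fun i => (f i).smooth ⊤
  have h2 : ∀ k : ℕ, (k : ℕ∞) ≤ (⊤ : ℕ∞) → Summable (fun j => sn 0 k (f j)) := fun k _ => hf 0 k
  have h3 : ∀ (k : ℕ) (i : ℕ) (x : ℝ), (k:ℕ∞) ≤ (⊤ : ℕ∞) → ‖iteratedFDeriv ℝ k (f i) x‖ ≤ sn 0 k (f i) :=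
    fun k i x _ => sn_bound k (f i) x
  have key : ∀ k n (x : ℝ), ‖x‖^k * ‖iteratedFDeriv ℝ n (fun y => ∑' j, f j y) x‖ ≤ ∑' j, sn k n (f j) := by
    intro k n x
    rw [iteratedFDeriv_tsum_apply h1 h2 h3 le_top]
    have hs : Summable (fun j => ‖iteratedFDeriv ℝ n (f j) x‖) :=
      Summable.of_nonneg_of_le (fun _ => norm_nonneg _) (fun j => sn_bound n (f j) x) (hf 0 n)
    refine (mul_le_mul_of_nonneg_left (norm_tsum_le_tsum_norm hs) (by positivity)).trans ?_
    rw [← tsum_mul_left]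
    exact (hs.mul_left _).tsum_le_tsum (fun j => SchwartzMap.le_seminorm ℂ k n (f j) x) (hf k n)
  let S : E := ⟨fun y => ∑' j, f j y, contDiff_tsum h1 h2 h3, fun k n => ⟨_, key k n⟩⟩
  refine ⟨S, fun x => rfl, fun k n => ?_⟩
  exact SchwartzMap.seminorm_le_bound ℂ k n S (tsum_nonneg fun j => apply_nonneg _ _) (key k n)

lemma sum_pointwise (f : ℕ → E) (hf : ∀ k n, Summable (fun j => sn k n (f j))) (x : ℝ) :
    Summable (fun j => f j x) := by
  refine Summable.of_norm_bounded (hf 0 0) (fun j => ?_)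
  simpa using sn_bound 0 (f j) x

lemma exists_kappa (G : ℕ → E) : ∃ κ : ℕ → ℝ, (∀ j, 0 < κ j) ∧
    ∀ k n, Summable (fun j => κ j * sn k n (G j)) := by
  let A : ℕ → ℝ := fun j => 1 + ∑ k ∈ Finset.range (j+1), ∑ n ∈ Finset.range (j+1), sn k n (G j)
  have hA : ∀ j, 0 < A j := fun j => by
    have : 0 ≤ ∑ k ∈ Finset.range (j+1), ∑ n ∈ Finset.range (j+1), sn k n (G j) :=
      Finset.sum_nonneg fun k _ => Finset.sum_nonneg fun n _ => apply_nonneg _ _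
    change 0 < 1 + _
    linarith
  refine ⟨fun j => (1/2)^j / A j, fun j => div_pos (by positivity) (hA j), fun k n => ?_⟩
  refine Summable.of_norm_bounded_eventually_nat (g := fun j => (1/2:ℝ)^j) summable_geometric_two ?_
  filter_upwards [eventually_ge_atTop (max k n)] with j hj
  have hk : k ∈ Finset.range (j+1) := by simp; omega
  have hn : n ∈ Finset.range (j+1) := by simp; omega
  have h1 : sn k n (G j) ≤ A j := by
    have e1 := Finset.single_le_sum (f := fun n => sn k n (G j)) (fun n _ => apply_nonneg _ _) hn
    have e2 := Finset.single_le_sum (f := fun k => ∑ n ∈ Finset.range (j+1), sn k n (G j))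
      (fun k _ => Finset.sum_nonneg fun n _ => apply_nonneg _ _) hk
    change _ ≤ 1 + _
    linarith
  rw [Real.norm_of_nonneg (mul_nonneg (div_nonneg (by positivity) (hA j).le) (apply_nonneg _ _)),
    div_mul_eq_mul_div, div_le_iff₀ (hA j)]
  gcongr

abbrev I := unitInterval

lemma sum_family (G : ℕ → E) : ∃ κ : ℕ → ℝ, (∀ j, 0 < κ j) ∧ ∃ Φ : (ℕ → I) → E, Continuous Φ ∧
    (∀ w x, Φ w x = ∑' j, ((((w j : ℝ) * κ j : ℝ) : ℂ)) * G j x) ∧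
    (∀ w N, (∀ j, N ≤ j → w j = 0) → Φ w = ∑ j ∈ Finset.range N, (((w j : ℝ) * κ j : ℝ) : ℂ) • G j) := by
  obtain ⟨κ, hκ, hs⟩ := exists_kappa G
  refine ⟨κ, hκ, ?_⟩
  have hsn : ∀ (c : ℝ) k n j, sn k n (((c * κ j : ℝ) : ℂ) • G j) = |c| * (κ j * sn k n (G j)) := by
    intro c k n j
    rw [map_smul_eq_mul, Complex.norm_real, Real.norm_eq_abs, abs_mul, abs_of_pos (hκ j), mul_assoc]
  have hsum : ∀ (c : ℕ → ℝ), (∀ j, |c j| ≤ 1) → ∀ k n, Summable (fun j => sn k n (((c j * κ j : ℝ) : ℂ) • G j)) := by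
    intro c hc k n
    refine Summable.of_nonneg_of_le (fun _ => apply_nonneg _ _) (fun j => ?_) (hs k n)
    rw [hsn]
    exact mul_le_of_le_one_left (mul_nonneg (hκ j).le (apply_nonneg _ _)) (hc j)
  have hw1 : ∀ (w : ℕ → I) j, |(w j : ℝ)| ≤ 1 := fun w j => by
    rw [abs_of_nonneg (w j).2.1]; exact (w j).2.2
  have hw2 : ∀ (w w' : ℕ → I) j, |(w j : ℝ) - w' j| ≤ 1 := fun w w' j => by
    have := (w j).2.1; have := (w j).2.2; have := (w' j).2.1; have := (w' j).2.2
    rw [abs_le]; constructor <;> linarith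
  choose Φ hΦ hΦs using fun w : ℕ → I => exists_sum _ (hsum (fun j => (w j : ℝ)) (hw1 w))
  have hΦ' : ∀ w x, Φ w x = ∑' j, ((((w j : ℝ) * κ j : ℝ) : ℂ)) * G j x := hΦ
  refine ⟨Φ, ?_, hΦ', ?_⟩
  · rw [continuous_iff_continuousAt]
    intro w0
    have hdiff : ∀ k n w, sn k n (Φ w - Φ w0) ≤ ∑' j, |(w j : ℝ) - w0 j| * (κ j * sn k n (G j)) := by
      intro k n w
      obtain ⟨S, hS, hS'⟩ := exists_sum _ (hsum (fun j => (w j : ℝ) - w0 j) (hw2 w w0))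
      have : Φ w - Φ w0 = S := by
        ext x
        change Φ w x - Φ w0 x = _
        rw [hS, hΦ, hΦ, ← (sum_pointwise _ (hsum _ (hw1 w)) x).tsum_sub (sum_pointwise _ (hsum _ (hw1 w0)) x)]
        congr 1
        ext j
        change (((w j : ℝ) * κ j : ℝ) : ℂ) * G j x - (((w0 j : ℝ) * κ j : ℝ) : ℂ) * G j x =
          ((((w j : ℝ) - w0 j) * κ j : ℝ) : ℂ) * G j x
        push_cast; ring
      rw [this]
      refine (hS' k n).trans (le_of_eq ?_)
      congr 1
      ext j
      rw [hsn]
    rw [ContinuousAt, (schwartz_withSeminorms ℂ ℝ ℂ).tendsto_nhds]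
    rintro ⟨k, n⟩ ε hε
    have hc : Continuous (fun w : ℕ → I => ∑' j, |(w j : ℝ) - w0 j| * (κ j * sn k n (G j))) := by
      refine continuous_tsum (fun j => by fun_prop) (hs k n) (fun j w => ?_)
      rw [Real.norm_of_nonneg (mul_nonneg (abs_nonneg _) (mul_nonneg (hκ j).le (apply_nonneg _ _)))]
      exact mul_le_of_le_one_left (mul_nonneg (hκ j).le (apply_nonneg _ _)) (hw2 w w0 j)
    have h0 := hc.tendsto w0
    simp only [sub_self, abs_zero, zero_mul, tsum_zero] at h0
    filter_upwards [h0.eventually (gt_mem_nhds hε)] with w hw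
    exact (hdiff k n w).trans_lt hw
  · intro w N hN
    ext x
    rw [hΦ', tsum_eq_sum (s := Finset.range N)]
    · simp
    · intro j hj
      rw [hN j (by simpa using hj)]
      simp

end FLC
end

section
open Filter Topology
open scoped FourierTransform ComplexOrder

namespace FLC

lemma eval_cont (x : ℝ) : Continuous (fun f : E => f x) := by
  have h := (SchwartzMap.toBoundedContinuousFunctionCLM ℂ ℝ ℂ).continuous
  exact (continuous_eval_const (F := BoundedContinuousFunction ℝ ℂ) x).comp h

/-- increasing family of seminorms -/
noncomputable def q (k : ℕ) : Seminorm ℂ E := (Finset.Iic (k,k)).sup (schwartzSeminormFamily ℂ ℝ ℂ)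

lemma q_cont (k : ℕ) : Continuous (q k) := by
  unfold q
  apply Seminorm.continuous_of_le (q := ∑ i ∈ Finset.Iic (k,k), schwartzSeminormFamily ℂ ℝ ℂ i)
  · have : ⇑(∑ i ∈ Finset.Iic (k,k), schwartzSeminormFamily ℂ ℝ ℂ i) =
      fun f => ∑ i ∈ Finset.Iic (k,k), schwartzSeminormFamily ℂ ℝ ℂ i f := by
      ext f
      rw [sum_apply]
    rw [this]
    exact continuous_finsetSum _ fun i _ => (schwartz_withSeminorms ℂ ℝ ℂ).continuous_seminorm i
  · exact Seminorm.finset_sup_le_sum _ _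

lemma q_basis (x : E) (U : Set E) (hU : U ∈ 𝓝 x) : ∃ k0, ∀ k, k0 ≤ k → ∀ y, q k (x - y) < 1/((k:ℝ)+1) → y ∈ U := by
  rw [(schwartz_withSeminorms ℂ ℝ ℂ).mem_nhds_iff] at hU
  obtain ⟨s, r, hr, hs⟩ := hU
  obtain ⟨k1, hk1⟩ := exists_nat_one_div_lt hr
  let k2 := s.sup (fun i => max i.1 i.2)
  refine ⟨max k1 k2, fun k hk y hy => hs ?_⟩
  rw [Seminorm.mem_ball, ← neg_sub, map_neg_eq_map]
  have hle : s.sup (schwartzSeminormFamily ℂ ℝ ℂ) ≤ q k := by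
    apply Finset.sup_mono
    intro i hi
    have : max i.1 i.2 ≤ k2 := Finset.le_sup (f := fun i : ℕ × ℕ => max i.1 i.2) hi
    rw [Finset.mem_Iic]
    constructor
    · change i.1 ≤ k; omega
    · change i.2 ≤ k; omega
  refine (hle _).trans_lt (hy.trans_le (le_trans ?_ hk1.le))
  have : (k1:ℝ) ≤ k := by exact_mod_cast (le_max_left _ _).trans hk
  gcongr

lemma mem_closure_of_q (x : E) (S : Set E) (h : ∀ k, ∃ y ∈ S, q k (x - y) < 1/((k:ℝ)+1)) : x ∈ closure S := by
  rw [mem_closure_iff_nhds]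
  intro U hU
  obtain ⟨k0, hk0⟩ := q_basis x U hU
  obtain ⟨y, hy, hq⟩ := h k0
  exact ⟨y, hk0 k0 le_rfl y hq, hy⟩

/-- closed span of far translates -/
noncomputable def Vs (a : ℝ) (g : E) (N : ℕ) : Submodule ℂ E :=
  (Submodule.span ℂ {f | ∃ n : ℕ, N ≤ n ∧ f = T (n * a) g}).topologicalClosure

lemma T_zero (f : E) : T 0 f = f := by
  ext x; simp

lemma T_mem_Vs (a : ℝ) (g : E) (N : ℕ) (f : E) (hf : f ∈ Vs a g N) (m : ℕ) : T (m * a) f ∈ Vs a g (N + m) := by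
  have h1 : (Vs a g N).map (T (m*a)).toLinearMap ≤ Vs a g (N+m) := by
    unfold Vs
    refine (Submodule.topologicalClosure_map _ _).trans ?_
    apply Submodule.topologicalClosure_mono
    rw [Submodule.map_span, Submodule.span_le]
    rintro _ ⟨_, ⟨n, hn, rfl⟩, rfl⟩
    apply Submodule.subset_span
    refine ⟨n + m, by omega, ?_⟩
    change T (m * a) (T (n*a) g) = _
    rw [T_add]
    congr 2
    push_cast; ring
  exact h1 ⟨f, hf, rfl⟩

lemma Vs_anti (a : ℝ) (g : E) {N N' : ℕ} (h : N ≤ N') : Vs a g N' ≤ Vs a g N := by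
  apply Submodule.topologicalClosure_mono
  apply Submodule.span_mono
  rintro f ⟨n, hn, rfl⟩
  exact ⟨n, h.trans hn, rfl⟩

lemma mem_Vs_all (a : ℝ) (g : E) (h : g ∈ Vs a g 1) (N : ℕ) : g ∈ Vs a g N := by
  induction N with
  | zero => exact Vs_anti a g (Nat.zero_le 1) h
  | succ N ih =>
    have h1 : Vs a g 1 ≤ Vs a g (N+1) := by
      refine Submodule.topologicalClosure_minimal _ ?_ (Submodule.isClosed_topologicalClosure _)
      rw [Submodule.span_le]
      rintro _ ⟨n, hn, rfl⟩
      exact Vs_anti a g (by omega) (T_mem_Vs a g N g ih n)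
    exact h1 h

lemma aeval_mem (a : ℝ) (g : E) (P : Polynomial ℂ) (m : ℕ) : Polynomial.aeval (T a) P (T (m * a) g) ∈
    Submodule.span ℂ {f | ∃ n : ℕ, m ≤ n ∧ f = T (n * a) g} := by
  induction P using Polynomial.induction_on' with
  | add p r hp hr =>
    rw [map_add, add_apply]; exact add_mem hp hr
  | monomial n c =>
    rw [Polynomial.aeval_monomial]
    have e : (algebraMap ℂ (E →L[ℂ] E) c * T a ^ n) (T (m * a) g) = c • ((T a ^ n) (T (m * a) g)) := by
      rw [Algebra.algebraMap_eq_smul_one, smul_mul_assoc, one_mul]; rfl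
    rw [e]
    apply Submodule.smul_mem
    apply Submodule.subset_span
    refine ⟨n + m, by omega, ?_⟩
    have : ∀ (n : ℕ) (f : E), (T a ^ n) f = T (n * a) f := by
      intro n
      induction n with
      | zero => intro f; simp only [Nat.cast_zero, zero_mul, T_zero, pow_zero]; rfl
      | succ n ih =>
        intro f
        rw [pow_succ', mul_apply_eq_comp, ih, T_add]
        congr 2; push_cast; ring
    rw [this, T_add]
    congr 2; push_cast; ring

lemma aeval_sub_mem (a : ℝ) (g : E) (Q : Polynomial ℂ) (hQ : Q.eval 0 = 1) :
    g - Polynomial.aeval (T a) Q g ∈ Submodule.span ℂ {f | ∃ n : ℕ, 1 ≤ n ∧ f = T (n * a) g} := by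
  have h := Q.divX_mul_X_add
  have hc : Q.coeff 0 = 1 := by rw [Polynomial.coeff_zero_eq_eval_zero, hQ]
  have e : Polynomial.aeval (T a) Q g = Polynomial.aeval (T a) Q.divX (T ((1:ℕ) * a) g) + g := by
    conv_lhs => rw [← h]
    rw [hc]
    simp
  rw [e, sub_add_cancel_right]
  exact neg_mem (aeval_mem a g _ 1)

lemma trunc_tendsto (w : ℕ → I) : Tendsto (fun N : ℕ => fun j => if j < N then w j else 0) atTop (𝓝 w) := by
  rw [tendsto_pi_nhds]
  intro j
  refine tendsto_const_nhds.congr' ?_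
  filter_upwards [eventually_gt_atTop j] with N hN
  rw [if_pos hN]

lemma exists_g (a : ℝ) : ∃ g : E, (∀ x, 0 ≤ g x) ∧ (∀ x, Real.cos (2 * Real.pi * a * x) ≠ -1 → 𝓕 g x ≠ 0) ∧
    ∀ N, g ∈ Vs a g N := by
  let O : Set ℝ := {x | Real.cos (2 * Real.pi * a * x) ≠ -1}
  have hO : IsOpen O := isOpen_ne_fun (by fun_prop) continuous_const
  obtain ⟨G, hG0, hGF, hGc, hGs, hGp⟩ := blocks O hO (by simp [O]; norm_num) (fun x hx => by
    simp only [O, Set.mem_ofPred_eq] at hx ⊢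
    rwa [mul_neg, Real.cos_neg])
  obtain ⟨κ, hκ, Φ, hΦc, hΦ, hΦf⟩ := sum_family G
  let A : ℕ → Set (ℕ → I) := fun j => {w | w j ≠ 0}
  let B : ℕ → Set (ℕ → I) := fun k => {w | ∃ Q : Polynomial ℂ, Q.eval 0 = 1 ∧
    q k (Polynomial.aeval (T a) Q (Φ w)) < 1/((k:ℝ)+1)}
  have hAo : ∀ j, IsOpen (A j) := fun j => isOpen_ne_fun (continuous_apply j) continuous_const
  have hAd : ∀ j, Dense (A j) := fun j =>
    (dense_compl_singleton (0 : I)).preimage (isOpenMap_eval j)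
  have hBo : ∀ k, IsOpen (B k) := fun k => by
    have : B k = ⋃ Q : {Q : Polynomial ℂ // Q.eval 0 = 1},
        {w | q k (Polynomial.aeval (T a) Q.1 (Φ w)) < 1/((k:ℝ)+1)} := by
      ext w; simp [B]
    rw [this]
    refine isOpen_iUnion fun Q => ?_
    exact isOpen_lt ((q_cont k).comp ((Polynomial.aeval (T a) Q.1).continuous.comp hΦc)) continuous_const
  have hBd : ∀ k, Dense (B k) := fun k w => by
    refine mem_closure_of_tendsto (trunc_tendsto w) (Eventually.of_forall fun N => ?_)
    set w' : ℕ → I := fun j => if j < N then w j else 0 with hw'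
    have hf := hΦf w' N (fun j hj => by simp [hw', hj])
    have hF : ∀ x, x ∈ Function.support (𝓕 (Φ w') : E) → ∃ j ∈ Finset.range N, x ∈ tsupport (𝓕 (G j) : E) := by
      intro x hx
      by_contra! hcon
      apply hx
      rw [hf]
      have : (𝓕 (∑ j ∈ Finset.range N, (((w' j : ℝ) * κ j : ℝ) : ℂ) • G j) : E) =
          ∑ j ∈ Finset.range N, (((w' j : ℝ) * κ j : ℝ) : ℂ) • (𝓕 (G j) : E) := by
        have := map_sum (FourierTransform.fourierCLM ℂ E) (fun j => (((w' j : ℝ) * κ j : ℝ) : ℂ) • G j) (Finset.range N)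
        simp only [map_smul] at this
        exact this
      rw [this, sum_apply]
      refine Finset.sum_eq_zero fun j hj => ?_
      change (((w' j : ℝ) * κ j : ℝ) : ℂ) * (𝓕 (G j) : E) x = 0
      rw [image_eq_zero_of_notMem_tsupport (hcon j hj), mul_zero]
    have hcomp : IsCompact (⋃ j ∈ Finset.range N, tsupport (𝓕 (G j) : E)) :=
      (Finset.range N).isCompact_biUnion fun j _ => hGc j
    have hts : tsupport (𝓕 (Φ w') : E) ⊆ ⋃ j ∈ Finset.range N, tsupport (𝓕 (G j) : E) := by
      refine closure_minimal (fun x hx => ?_) hcomp.isClosed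
      simpa using hF x hx
    obtain ⟨Q, hQ0, hQ⟩ := core a (Φ w') (hcomp.of_isClosed_subset (isClosed_tsupport _) hts) (fun x hx => by
      have := hts hx
      simp only [Set.mem_iUnion] at this
      obtain ⟨j, _, hj⟩ := this
      exact hGs j hj)
    have hq := ((q_cont k).tendsto 0).comp hQ
    rw [map_zero] at hq
    obtain ⟨n, hn⟩ := (hq.eventually (gt_mem_nhds (show (0:ℝ) < 1/((k:ℝ)+1) by positivity))).exists
    exact ⟨Q^n, by simp [hQ0], hn⟩
  obtain ⟨w, hw⟩ := (dense_iInter_of_isOpen (f := fun i : ℕ ⊕ ℕ => Sum.elim A B i)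
    (by rintro (j|k); exacts [hAo j, hBo k]) (by rintro (j|k); exacts [hAd j, hBd k])).nonempty
  rw [Set.mem_iInter] at hw
  have hwA : ∀ j, w j ≠ 0 := fun j => hw (Sum.inl j)
  have hwB : ∀ k, w ∈ B k := fun k => hw (Sum.inr k)
  refine ⟨Φ w, fun x => ?_, fun x hx => ?_, mem_Vs_all a _ ?_⟩
  · have hnn : ∀ (w : ℕ → I) j, (0:ℂ) ≤ (((w j : ℝ) * κ j : ℝ) : ℂ) := fun w j =>
      Complex.zero_le_real.mpr (mul_nonneg (w j).2.1 (hκ j).le)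
    rw [hΦ]
    exact tsum_nonneg fun j => mul_nonneg (hnn w j) (hG0 j x)
  · obtain ⟨j, hj⟩ := hGp x hx
    have hc : Continuous (fun w => (𝓕 (Φ w) : E) x) :=
      (eval_cont x).comp ((FourierTransform.fourierCLM ℂ E).continuous.comp hΦc)
    have ht := (hc.tendsto w).comp (trunc_tendsto w)
    have hpos : (0:ℂ) < (((w j : ℝ) * κ j : ℝ) : ℂ) * 𝓕 (G j) x :=
      mul_pos (Complex.zero_lt_real.mpr (mul_pos (lt_of_le_of_ne (w j).2.1 (fun h => hwA j (Subtype.ext h.symm))) (hκ j))) hj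
    refine (lt_of_lt_of_le hpos (ge_of_tendsto ht ?_)).ne'
    filter_upwards [eventually_gt_atTop j] with N hN
    simp only [Function.comp]
    set w' : ℕ → I := fun j => if j < N then w j else 0 with hw'
    have hf := hΦf w' N (fun j hj => by simp [hw', hj])
    have : (𝓕 (∑ j ∈ Finset.range N, (((w' j : ℝ) * κ j : ℝ) : ℂ) • G j) : E) =
          ∑ j ∈ Finset.range N, (((w' j : ℝ) * κ j : ℝ) : ℂ) • (𝓕 (G j) : E) := by
        have := map_sum (FourierTransform.fourierCLM ℂ E) (fun j => (((w' j : ℝ) * κ j : ℝ) : ℂ) • G j) (Finset.range N)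
        simp only [map_smul] at this
        exact this
    rw [hf, this, sum_apply]
    have hnn : ∀ i ∈ Finset.range N, 0 ≤ ((((w' i : ℝ) * κ i : ℝ) : ℂ) • (𝓕 (G i) : E)) x := fun i _ =>
      mul_nonneg (Complex.zero_le_real.mpr (mul_nonneg (w' i).2.1 (hκ i).le)) (hGF i x)
    have h1 := Finset.single_le_sum hnn (Finset.mem_range.2 hN)
    refine le_trans (le_of_eq ?_) h1
    simp only [hw', if_pos hN]
    rfl
  · apply mem_closure_of_q
    intro k
    obtain ⟨Q, hQ, hq⟩ := hwB k
    exact ⟨_, aeval_sub_mem a (Φ w) Q hQ, by rwa [_root_.sub_sub_cancel]⟩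

end FLC
end

section
open Filter Topology
open scoped FourierTransform ComplexOrder

namespace FLC

lemma dense_comb (a b : ℝ) (ha : 0 < a) (hab : LinearIndependent ℚ ![a, b]) (t ε : ℝ) (hε : 0 < ε) :
    ∃ (m : ℕ) (l : ℤ), |m * b + l * a - t| < ε := by
  have hirr : Irrational (b / a) := by
    rw [Irrational]
    rintro ⟨c, hc⟩
    rw [LinearIndependent.pair_iff] at hab
    have := hab c (-1) (by
      simp only [Rat.smul_def]
      rw [hc]; push_cast; field_simp; ring)
    norm_num at this
  have : Fact (0 < a) := ⟨ha⟩
  have hd := denseRange_zsmul_iff_nsmul.1 (AddCircle.denseRange_zsmul_coe_iff.2 hirr)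
  have hU : IsOpen (Set.image (fun x : ℝ => (x : AddCircle a)) (Metric.ball t ε)) :=
    QuotientAddGroup.isOpenMap_coe _ Metric.isOpen_ball
  obtain ⟨m, x, hx, hm⟩ := hd.exists_mem_open hU ⟨_, t, Metric.mem_ball_self hε, rfl⟩
  have h2 : ((m * b - x : ℝ) : AddCircle a) = 0 := by
    have hm' : (x : AddCircle a) = m • (b : AddCircle a) := hm
    rw [AddCircle.coe_sub, hm', ← nsmul_eq_mul]
    simp
  rw [AddCircle.coe_eq_zero_iff] at h2
  obtain ⟨l, hl⟩ := h2
  refine ⟨m, -l, ?_⟩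
  rw [Metric.mem_ball, Real.dist_eq] at hx
  have : (m:ℝ) * b + ((-l : ℤ) : ℝ) * a - t = x - t := by
    rw [zsmul_eq_mul] at hl; push_cast; linarith
  rwa [this]

noncomputable def lamσ (a b : ℝ) (σ : ℕ → Bool) (n : ℕ) : ℝ := ∑ i ∈ Finset.range n, if σ i then b else a

lemma lam_cont (a b : ℝ) (n : ℕ) (g : E) : Continuous (fun σ : ℕ → Bool => T (lamσ a b σ n) g) := by
  have h1 : Continuous (fun σ : ℕ → Bool => fun i : Fin n => σ i) := by fun_prop
  have h2 : Continuous (fun τ : Fin n → Bool => T (∑ i, if τ i then b else a) g) :=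
    continuous_of_discreteTopology
  have := h2.comp h1
  refine this.congr fun σ => ?_
  simp only [Function.comp, lamσ, Finset.sum_range]

lemma span_form (u : ℕ → E) (y : E) (hy : y ∈ Submodule.span ℂ {f | ∃ n : ℕ, 1 ≤ n ∧ f = u n}) :
    ∃ (N : ℕ) (c : ℕ → ℂ), y = ∑ n ∈ Finset.range N, c n • u (n+1) := by
  have : {f | ∃ n : ℕ, 1 ≤ n ∧ f = u n} = Set.range (fun n => u (n+1)) := by
    ext f
    constructor
    · rintro ⟨n, hn, rfl⟩
      exact ⟨n-1, by simp only; congr 1; omega⟩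
    · rintro ⟨n, rfl⟩
      exact ⟨n+1, by omega, rfl⟩
  rw [this, Finsupp.mem_span_range_iff_exists_finsupp] at hy
  obtain ⟨c, rfl⟩ := hy
  refine ⟨c.support.sup id + 1, c, ?_⟩
  rw [Finsupp.sum]
  apply Finset.sum_subset
  · intro i hi
    rw [Finset.mem_range, Nat.lt_succ_iff]
    exact Finset.le_sup (f := id) hi
  · intro i _ hi
    rw [Finsupp.notMem_support_iff.1 hi, zero_smul]

lemma exists_lam (a b : ℝ) (ha : 0 < a) (hab : LinearIndependent ℚ ![a, b]) (g : E)
    (hg : ∀ N, g ∈ Vs a g N) :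
    ∃ lam : ℕ → ℝ, (∀ n, lam (n+1) - lam n ∈ ({a, b} : Set ℝ)) ∧
      ∀ (k : ℕ) (r : ℚ), ∃ s : ℝ, |s - r| < 1/((k:ℝ)+1) ∧
        ∃ y ∈ Submodule.span ℂ {f | ∃ n : ℕ, 1 ≤ n ∧ f = T (lam n) g}, q k (T s g - y) < 1/((k:ℝ)+1) := by
  let D : ℕ × ℚ → Set (ℕ → Bool) := fun i => ⋃ (s : {s : ℝ // |s - i.2| < 1/((i.1:ℝ)+1)}), ⋃ (N : ℕ), ⋃ (c : ℕ → ℂ),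
    {σ | q i.1 (T s.1 g - ∑ n ∈ Finset.range N, c n • T (lamσ a b σ (n+1)) g) < 1/((i.1:ℝ)+1)}
  have hDo : ∀ i, IsOpen (D i) := fun i => by
    refine isOpen_iUnion fun s => isOpen_iUnion fun N => isOpen_iUnion fun c => ?_
    refine isOpen_lt ((q_cont _).comp (continuous_const.sub (continuous_finsetSum _ fun n _ => ?_))) continuous_const
    exact (lam_cont a b (n+1) g).const_smul (c n)
  have hDd : ∀ i, Dense (D i) := by
    rintro ⟨k, r⟩ σ
    have key : ∀ L : ℕ, ∃ m : ℕ, (fun i => if i < L then σ i else decide (i < L + m)) ∈ D (k, r) := by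
      intro L
      obtain ⟨m, l, hml⟩ := dense_comb a b ha hab (r - lamσ a b σ L) (1/((k:ℝ)+1)) (by positivity)
      refine ⟨m, ?_⟩
      set τ : ℕ → Bool := fun i => if i < L then σ i else decide (i < L + m) with hτ
      have hlam : ∀ n : ℕ, lamσ a b τ (L + m + n) = lamσ a b σ L + m * b + n * a := by
        intro n
        unfold lamσ
        rw [Finset.sum_range_add, Finset.sum_range_add]
        congr 1
        · congr 1
          · refine Finset.sum_congr rfl fun i hi => ?_
            simp [hτ, Finset.mem_range.1 hi]
          · rw [Finset.sum_congr rfl (g := fun _ => b)]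
            · simp
            · intro i hi
              have := Finset.mem_range.1 hi
              simp [hτ, this]
        · rw [Finset.sum_congr rfl (g := fun _ => a)]
          · simp
          · intro i hi
            simp [hτ, show ¬ (L + m + i < L) by omega]
      set s := lamσ a b σ L + m * b + l * a with hs
      have hsr : |s - r| < 1/((k:ℝ)+1) := by
        rw [hs]; convert hml using 2; ring
      have hV := hg (l.natAbs + 1)
      have hV' : g ∈ closure (Submodule.span ℂ {f | ∃ n : ℕ, l.natAbs + 1 ≤ n ∧ f = T (n * a) g} : Set E) := hV
      have hcont : Continuous (fun y => q k (T s g - T s y)) :=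
        (q_cont k).comp (continuous_const.sub (T s).continuous)
      have hop : IsOpen {y | q k (T s g - T s y) < 1/((k:ℝ)+1)} := isOpen_lt hcont continuous_const
      obtain ⟨y, hy1, hy2⟩ := mem_closure_iff.1 hV' _ hop (by
        change q k (T s g - T s g) < _
        rw [sub_self, map_zero]; positivity)
      have hy3 : T s y ∈ Submodule.span ℂ {f | ∃ n : ℕ, 1 ≤ n ∧ f = T (lamσ a b τ n) g} := by
        have : (Submodule.span ℂ {f | ∃ n : ℕ, l.natAbs + 1 ≤ n ∧ f = T (n * a) g}).map (T s).toLinearMap ≤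
            Submodule.span ℂ {f | ∃ n : ℕ, 1 ≤ n ∧ f = T (lamσ a b τ n) g} := by
          rw [Submodule.map_span, Submodule.span_le]
          rintro _ ⟨_, ⟨n, hn, rfl⟩, rfl⟩
          apply Submodule.subset_span
          obtain ⟨j, hj⟩ : ∃ j : ℕ, (j : ℤ) = l + n := ⟨(l + n).toNat, by omega⟩
          refine ⟨L + m + j, by omega, ?_⟩
          change T s (T (n*a) g) = _
          rw [T_add, hlam, hs]
          congr 2
          have : (j:ℝ) = l + n := by exact_mod_cast hj
          rw [this]; ring
        exact this ⟨y, hy2, rfl⟩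
      obtain ⟨N, c, hc⟩ := span_form (fun n => T (lamσ a b τ n) g) _ hy3
      simp only [D, Set.mem_iUnion]
      refine ⟨⟨s, hsr⟩, N, c, ?_⟩
      change q k (T s g - ∑ n ∈ Finset.range N, c n • T (lamσ a b τ (n+1)) g) < _
      rw [← hc]
      exact hy1
    choose m hm using key
    refine mem_closure_of_tendsto (f := fun L => fun i => if i < L then σ i else decide (i < L + m L)) (b := atTop) ?_
      (Eventually.of_forall hm)
    rw [tendsto_pi_nhds]
    intro j
    refine tendsto_const_nhds.congr' ?_
    filter_upwards [eventually_gt_atTop j] with N hN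
    rw [if_pos hN]
  obtain ⟨σ, hσ⟩ := (dense_iInter_of_isOpen hDo hDd).nonempty
  refine ⟨lamσ a b σ, fun n => ?_, fun k r => ?_⟩
  · unfold lamσ
    rw [Finset.sum_range_succ, add_sub_cancel_left]
    split_ifs <;> simp
  · have := Set.mem_iInter.1 hσ (k, r)
    simp only [D, Set.mem_iUnion] at this
    obtain ⟨⟨s, hs⟩, N, c, hc⟩ := this
    refine ⟨s, hs, _, ?_, hc⟩
    refine Submodule.sum_mem _ fun n _ => Submodule.smul_mem _ _ (Submodule.subset_span ⟨n+1, by omega, rfl⟩)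

end FLC
end

section
open Filter Topology
open scoped FourierTransform ComplexOrder
namespace FLC

/-- Sup bound for the inverse Fourier transform. -/
theorem finv_le (u : E) (x : ℝ) : ‖(𝓕⁻ u : E) x‖ ≤ ∫ y, ‖u y‖ := by
  rw [SchwartzMap.fourierInv_coe, Real.fourierInv_eq]
  refine (norm_integral_le_integral_norm _).trans (le_of_eq ?_)
  congr 1; ext y; simp

/-- Decay bound for the inverse Fourier transform. -/
theorem finv_le' (u : E) (x : ℝ) : |x| * ‖(𝓕⁻ u : E) x‖ ≤ ∫ y, ‖deriv u y‖ := by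
  have h1 := finv_le (LineDeriv.lineDerivOp (1:ℝ) u) x
  rw [SchwartzMap.fourierInv_lineDerivOp_eq] at h1
  have h2 : ∀ y, (LineDeriv.lineDerivOp (1:ℝ) u : E) y = deriv u y := by
    intro y
    rw [SchwartzMap.lineDerivOp_apply]
    simp only [lineDeriv, smul_eq_mul, mul_one]
    rw [deriv_comp_const_add]; simp
  have ht : (fun y : ℝ => inner ℝ y (1:ℝ)).HasTemperateGrowth := by fun_prop
  simp only [h2, smul_apply, SchwartzMap.smulLeftCLM_apply_apply ht, norm_smul] at h1
  have h3 : |x| * ‖(𝓕⁻ u : E) x‖ ≤ ‖-(2 * (Real.pi:ℂ) * Complex.I)‖ * (‖inner ℝ x (1:ℝ)‖ * ‖(𝓕⁻ u : E) x‖) := by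
    have : ‖-(2 * (Real.pi:ℂ) * Complex.I)‖ = 2 * Real.pi := by
      simp [abs_of_pos Real.pi_pos]
    rw [this]
    have h4 : ‖inner ℝ x (1:ℝ)‖ = |x| := by simp
    rw [h4]
    have h5 : 0 ≤ |x| * ‖(𝓕⁻ u : E) x‖ := by positivity
    nlinarith [Real.pi_gt_three]
  exact h3.trans h1

/-- The crucial `L^p` estimate for `p > 1`. -/
theorem finv_tendsto {p : ℝ} (hp : 1 < p) [Fact (1 ≤ ENNReal.ofReal p)] (u : ℕ → E) (C : ℝ)
    (h0 : Tendsto (fun n => ∫ y, ‖u n y‖) atTop (𝓝 0))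
    (hC : ∀ n, ∫ y, ‖deriv (u n) y‖ ≤ C) :
    Tendsto (fun n => SchwartzMap.toLp (𝓕⁻ (u n) : E) (ENNReal.ofReal p) volume) atTop (𝓝 0) := by
  have hp0 : 0 < p := by linarith
  set θ : ℝ := (p - 1) / (2 * p) with hθ
  have hθ0 : 0 < θ := by rw [hθ]; apply div_pos <;> linarith
  have hθ1 : 0 < 1 - θ := by
    rw [hθ, sub_pos, div_lt_one (by linarith)]; linarith
  have hθp : (1 - θ) * p = (1 + p) / 2 := by
    rw [hθ]; field_simp; ring
  set h : ℝ → ℝ := fun x => (1 + ‖x‖) ^ (-(1 - θ)) with hh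
  have hhc : Continuous h := by
    apply Continuous.rpow_const (by fun_prop)
    intro x; left; positivity
  have hmem : MemLp h (ENNReal.ofReal p) volume := by
    rw [← integrable_norm_rpow_iff hhc.aestronglyMeasurable (by simp [hp0]) (by simp)]
    have := integrable_one_add_norm (E := ℝ) (μ := volume) (r := (1+p)/2) (by simp; linarith)
    refine this.congr (Eventually.of_forall fun x => ?_)
    show (1 + ‖x‖) ^ (-((1 + p) / 2)) = ‖(1 + ‖x‖) ^ (-(1 - θ))‖ ^ (ENNReal.ofReal p).toReal
    rw [Real.norm_of_nonneg (show (0:ℝ) ≤ (1 + ‖x‖) ^ (-(1 - θ)) by positivity), ENNReal.toReal_ofReal hp0.le, ← Real.rpow_mul (by positivity)]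
    congr 1; rw [← hθp]; ring
  set ε : ℕ → ℝ := fun n => ∫ y, ‖u n y‖ with hε
  have hε0 : ∀ n, 0 ≤ ε n := fun n => integral_nonneg fun _ => norm_nonneg _
  have key : ∀ n x, ‖(𝓕⁻ (u n) : E) x‖ ≤ ((ε n) ^ θ * (ε n + C) ^ (1 - θ)) * ‖h x‖ := by
    intro n x
    set t := ‖(𝓕⁻ (u n) : E) x‖ with ht
    have ht0 : 0 ≤ t := norm_nonneg _
    have h1 : t ≤ ε n := finv_le (u n) x
    have h2 : |x| * t ≤ C := (finv_le' (u n) x).trans (hC n)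
    have h3 : (1 + ‖x‖) * t ≤ ε n + C := by rw [Real.norm_eq_abs]; linarith
    have h4 : t ≤ (ε n + C) * (1 + ‖x‖)⁻¹ := by
      rw [← div_eq_mul_inv, le_div_iff₀ (by positivity)]; linarith
    have hC0 : 0 ≤ ε n + C := le_trans (by positivity) h3
    have h5 : t = t ^ θ * t ^ (1 - θ) := by
      rw [← Real.rpow_add' ht0 (by norm_num)]; simp
    rw [h5, mul_assoc]
    have h6 : (ε n + C) ^ (1 - θ) * ‖h x‖ = ((ε n + C) * (1 + ‖x‖)⁻¹) ^ (1 - θ) := by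
      rw [Real.mul_rpow hC0 (by positivity), Real.inv_rpow (by positivity), ← Real.rpow_neg (by positivity)]
      congr 1
      exact Real.norm_of_nonneg (by positivity)
    rw [h6]
    gcongr
  rw [tendsto_zero_iff_norm_tendsto_zero]
  have hb : ∀ n, ‖SchwartzMap.toLp (𝓕⁻ (u n) : E) (ENNReal.ofReal p) volume‖ ≤
      ((ε n) ^ θ * (ε n + C) ^ (1 - θ)) * (eLpNorm h (ENNReal.ofReal p) volume).toReal := by
    intro n
    rw [SchwartzMap.norm_toLp]
    have hC0 : 0 ≤ C := (integral_nonneg fun _ => norm_nonneg _).trans (hC n)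
    have := eLpNorm_le_mul_eLpNorm_of_ae_le_mul (μ := volume) (Eventually.of_forall (key n)) (ENNReal.ofReal p)
    have h7 := ENNReal.toReal_mono (ENNReal.mul_ne_top ENNReal.ofReal_ne_top hmem.eLpNorm_ne_top) this
    rw [ENNReal.toReal_mul, ENNReal.toReal_ofReal (by have := hε0 n; positivity)] at h7
    exact h7
  refine squeeze_zero (fun n => norm_nonneg _) hb ?_
  have l1 : Tendsto (fun n => ε n ^ θ) atTop (𝓝 0) := by
    have := h0.rpow_const (p := θ) (Or.inr hθ0.le)
    rwa [Real.zero_rpow hθ0.ne'] at this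
  have l2 : Tendsto (fun n => (ε n + C) ^ (1 - θ)) atTop (𝓝 ((0 + C) ^ (1 - θ))) :=
    (h0.add_const C).rpow_const (Or.inr hθ1.le)
  simpa using (l1.mul l2).mul_const (eLpNorm h (ENNReal.ofReal p) volume).toReal

/-- Translation is continuous into `L^p`. -/
theorem tau_cont {P : ℝ≥0∞} [Fact (1 ≤ P)] (hP : P ≠ ⊤) (g : E) :
    Continuous (fun s : ℝ => SchwartzMap.toLp (T s g) P volume) := by
  have hc : Continuous (fun s : ℝ => (⟨fun x => x - s, by fun_prop⟩ : C(ℝ, ℝ))) := by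
    refine ContinuousMap.continuous_of_continuous_uncurry _ ?_
    show Continuous fun z : ℝ × ℝ => z.2 - z.1
    fun_prop
  have := Continuous.compMeasurePreservingLp (μ := volume) (ν := volume)
    (f := fun _ : ℝ => SchwartzMap.toLp g P volume) continuous_const hc
    (fun s => measurePreserving_sub_right volume s) hP
  convert this using 2 with s
  apply Lp.ext
  refine (SchwartzMap.coeFn_toLp _ _ _).trans ?_
  refine EventuallyEq.trans ?_ (Lp.coeFn_compMeasurePreserving _ (measurePreserving_sub_right volume s)).symm
  have h1 := (measurePreserving_sub_right volume s).quasiMeasurePreserving.ae_eq_comp (SchwartzMap.coeFn_toLp g P volume)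
  refine EventuallyEq.trans (Eventually.of_forall fun x => ?_) h1.symm
  simp [T]

theorem tau_norm {P : ℝ≥0∞} [Fact (1 ≤ P)] (g : E) (s : ℝ) :
    ‖SchwartzMap.toLp (T s g) P volume‖ = ‖SchwartzMap.toLp g P volume‖ := by
  rw [SchwartzMap.norm_toLp, SchwartzMap.norm_toLp]
  congr 1
  rw [← eLpNorm_comp_measurePreserving g.continuous.aestronglyMeasurable (measurePreserving_sub_right volume s)]
  rfl

/-- Convolution as a Bochner integral of translates. -/
theorem conv_eq {P : ℝ≥0∞} [Fact (1 ≤ P)] (hP : P ≠ ⊤) (g φ : E) (l : Lp ℂ P (volume : Measure ℝ) →L[ℂ] ℂ)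
    (hl : ∀ s, l (SchwartzMap.toLp (T s g) P volume) = 0) :
    l (SchwartzMap.toLp (SchwartzMap.convolution (ContinuousLinearMap.mul ℂ ℂ) φ g) P volume) = 0 := by
  set τ : ℝ → Lp ℂ P (volume : Measure ℝ) := fun s => SchwartzMap.toLp (T s g) P volume with hτ
  have h_integ : Integrable (fun s => φ s • τ s) := by
    refine (φ.integrable.norm.mul_const ‖SchwartzMap.toLp g P volume‖).mono'
      (φ.continuous.smul (tau_cont hP g)).aestronglyMeasurable (Eventually.of_forall fun s => ?_)
    rw [norm_smul, hτ, tau_norm]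
  have hG : ∫ s, φ s • τ s = SchwartzMap.toLp (SchwartzMap.convolution (ContinuousLinearMap.mul ℂ ℂ) φ g) P volume := by
    rw [← sub_eq_zero]
    have hk := Lp.ker_toTemperedDistributionCLM_eq_bot (F := ℂ) (μ := (volume : Measure ℝ)) (p := P)
    rw [LinearMap.ker_eq_bot'] at hk
    apply hk
    rw [map_sub, sub_eq_zero]
    ext χ
    have hcalc : ∀ f : Lp ℂ P (volume : Measure ℝ), Lp.toTemperedDistributionCLM ℂ volume P f χ =
        (PointwiseConvergenceCLM.evalCLM (RingHom.id ℂ) ℂ χ ∘L Lp.toTemperedDistributionCLM ℂ volume P) f := fun f => rfl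
    simp only [ContinuousLinearMap.coe_coe]
    rw [hcalc, ← ContinuousLinearMap.integral_comp_comm _ h_integ]
    simp only [map_smul, ← hcalc, hτ]
    simp only [Lp.toTemperedDistributionCLM_apply, Lp.toTemperedDistribution_toLp_eq,
      SchwartzMap.toTemperedDistributionCLM_apply_apply, SchwartzMap.convolution_apply, convolution]
    simp only [smul_eq_mul, ← integral_const_mul, ContinuousLinearMap.mul_apply']
    rw [integral_integral_swap]
    · congr 1; funext s
      show φ s * ((SchwartzMap.toTemperedDistributionCLM ℝ ℂ volume) ((T s) g)) χ = _
      have hev := SchwartzMap.toTemperedDistributionCLM_apply_apply volume (T s g) χ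
      refine (congrArg (fun z => φ s * z) hev).trans ?_
      rw [← integral_const_mul]
      congr 1; funext x
      simp only [T, SchwartzMap.compSubConstCLM_apply, smul_eq_mul]; ring
    · have h1 : Integrable (fun z : ℝ × ℝ => χ z.1 * φ z.2) (volume.prod volume) := χ.integrable.mul_prod φ.integrable
      obtain ⟨C, hC⟩ : ∃ C, ∀ x, ‖g x‖ ≤ C := ⟨_, fun x => SchwartzMap.norm_le_seminorm ℝ g x⟩
      have h2 := h1.mul_bdd (g := fun z : ℝ × ℝ => g (z.1 - z.2)) (c := C)
        (g.continuous.comp (by fun_prop)).aestronglyMeasurable (Eventually.of_forall fun z => hC _)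
      refine h2.congr (Eventually.of_forall fun z => ?_)
      simp [Function.uncurry, mul_assoc]
  rw [← hG, ← l.integral_comp_comm h_integ]
  simp [hτ, hl]
end FLC
end

section
open Filter Topology
open scoped FourierTransform ComplexOrder ContDiff
namespace FLC

/-- A smooth cutoff. -/
theorem exists_cut : ∃ B : E, (∀ x, |x| ≤ 1 → B x = 1) ∧ HasCompactSupport B := by
  let f : ContDiffBump (0:ℝ) := ⟨1, 2, by norm_num, by norm_num⟩
  have h1 : HasCompactSupport (fun x => ((f x : ℝ) : ℂ)) := f.hasCompactSupport.comp_left (g := fun x : ℝ => (x : ℂ)) (by simp)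
  have h2 : ContDiff ℝ ∞ (fun x => ((f x : ℝ) : ℂ)) := Complex.ofRealCLM.contDiff.comp f.contDiff
  refine ⟨h1.toSchwartzMap h2, fun x hx => ?_, h1⟩
  show ((f x : ℝ) : ℂ) = 1
  rw [f.one_of_mem_closedBall (by simpa [f] using hx)]; simp

theorem cut_temp (B : E) (c z : ℝ) : (fun x : ℝ => B (c * (x - z))).HasTemperateGrowth := by
  have h1 : (fun x : ℝ => c * (x - z)).HasTemperateGrowth := by fun_prop
  exact B.hasTemperateGrowth.comp h1

theorem cut_deriv (B u : E) (c z x : ℝ) :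
    deriv (M (fun x : ℝ => B (c * (x - z))) u) x =
      c * deriv B (c * (x - z)) * u x + B (c * (x - z)) * deriv u x := by
  have h0 : (M (fun x : ℝ => B (c * (x - z))) u : ℝ → ℂ) = fun x => B (c * (x - z)) * u x := by
    funext y; exact M_apply (cut_temp B c z) u y
  rw [h0]
  have h1 : HasDerivAt (fun x : ℝ => c * (x - z)) c x := by
    simpa using ((hasDerivAt_id x).sub_const z).const_mul c
  have h2 : HasDerivAt (fun x : ℝ => B (c * (x - z))) (c • deriv B (c * (x - z))) x :=
    (B.differentiable _).hasDerivAt.scomp x h1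
  have h3 := h2.mul (u.differentiable x).hasDerivAt
  refine h3.deriv.trans ?_; simp

theorem deriv_integrable (u : E) : Integrable (fun x => ‖deriv u x‖) := by
  have := (SchwartzMap.derivCLM ℂ ℂ u).integrable (μ := volume)
  exact (this.congr (Eventually.of_forall fun x => SchwartzMap.derivCLM_apply ℂ u x)).norm

theorem deriv_bdd (u : E) : ∃ C, 0 ≤ C ∧ ∀ x, ‖deriv u x‖ ≤ C := by
  refine ⟨SchwartzMap.seminorm ℝ 0 0 (SchwartzMap.derivCLM ℝ ℂ u), apply_nonneg _ _, fun x => ?_⟩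
  simpa using SchwartzMap.norm_le_seminorm ℝ (SchwartzMap.derivCLM ℝ ℂ u) x

theorem bdd (u : E) : ∃ C, 0 ≤ C ∧ ∀ x, ‖u x‖ ≤ C :=
  ⟨SchwartzMap.seminorm ℝ 0 0 u, apply_nonneg _ _, fun x => SchwartzMap.norm_le_seminorm ℝ u x⟩

theorem int_scale (f : ℝ → ℝ) (c z : ℝ) (hc : 0 < c) : ∫ x, f (c * (x - z)) = c⁻¹ * ∫ x, f x := by
  rw [integral_sub_right_eq_self (fun x => f (c * x)) z, Measure.integral_comp_mul_left]
  rw [abs_of_pos (by positivity)]; rfl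

theorem integrable_scale (f : ℝ → ℝ) (hf : Integrable f) (c z : ℝ) (hc : 0 < c) :
    Integrable fun x => f (c * (x - z)) :=
  (hf.comp_mul_left' hc.ne').comp_sub_right z

variable {p : ℝ}

/-- Cutting near a point is negligible. -/
theorem point_small (hp : 1 < p) [Fact (1 ≤ ENNReal.ofReal p)] (B u : E) (z : ℝ) :
    Tendsto (fun n : ℕ => SchwartzMap.toLp (𝓕⁻ (M (fun x : ℝ => B (((n:ℝ)+1) * (x - z))) u) : E)
      (ENNReal.ofReal p) volume) atTop (𝓝 0) := by
  obtain ⟨C, hC0, hC⟩ := bdd u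
  obtain ⟨D, hD0, hD⟩ := bdd B
  apply finv_tendsto hp _ (C * (∫ x, ‖deriv B x‖) + D * ∫ x, ‖deriv u x‖)
  · refine squeeze_zero (g := fun n : ℕ => C * (((n:ℝ)+1)⁻¹ * ∫ x, ‖B x‖)) (fun n => integral_nonneg fun _ => norm_nonneg _) ?_ ?_
    · intro n
      rw [← int_scale (fun x => ‖B x‖) _ z (by positivity), ← integral_const_mul]
      refine integral_mono (SchwartzMap.integrable _).norm ((integrable_scale _ B.integrable.norm _ z (by positivity)).const_mul C) fun x => ?_
      simp only [M_apply (cut_temp B _ z), norm_mul]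
      rw [mul_comm]
      gcongr; exact hC x
    · have : Tendsto (fun n : ℕ => ((n:ℝ)+1)⁻¹) atTop (𝓝 0) := by
        simpa using tendsto_one_div_add_atTop_nhds_zero_nat (𝕜 := ℝ)
      simpa using (this.mul_const (∫ x, ‖B x‖)).const_mul C
  · intro n
    have hn : (0:ℝ) < (n:ℝ) + 1 := by positivity
    have e : ∫ x, ‖deriv B x‖ = ((n:ℝ)+1) * ∫ x, ‖deriv B (((n:ℝ)+1) * (x - z))‖ := by
      rw [int_scale (fun x => ‖deriv B x‖) _ z hn, ← mul_assoc, mul_inv_cancel₀ hn.ne', one_mul]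
    have i1 := integrable_scale _ (deriv_integrable B) _ z hn
    rw [e, ← integral_const_mul, ← integral_const_mul, ← integral_const_mul,
      ← integral_add ((i1.const_mul _).const_mul _) ((deriv_integrable u).const_mul _)]
    refine integral_mono (deriv_integrable _) (((i1.const_mul _).const_mul _).add ((deriv_integrable u).const_mul _)) fun x => ?_
    simp only [cut_deriv]
    refine (norm_add_le _ _).trans ?_
    rw [norm_mul, norm_mul, norm_mul]
    have : ‖(((n:ℝ)+1 : ℝ) : ℂ)‖ = (n:ℝ)+1 := by rw [Complex.norm_real, Real.norm_of_nonneg hn.le]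
    rw [this]
    rw [mul_comm _ ‖u x‖]
    gcongr
    · exact hC x
    · exact hD _

/-- Cutting near infinity is negligible. -/
theorem infty_small (hp : 1 < p) [Fact (1 ≤ ENNReal.ofReal p)] (B u : E) (hB : ∀ x, |x| ≤ 1 → B x = 1) :
    Tendsto (fun n : ℕ => SchwartzMap.toLp (𝓕⁻ (u - M (fun x : ℝ => B (((n:ℝ)+1)⁻¹ * (x - 0))) u) : E)
      (ENNReal.ofReal p) volume) atTop (𝓝 0) := by
  obtain ⟨D, hD0, hD⟩ := bdd B
  obtain ⟨D', hD0', hD'⟩ := deriv_bdd B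
  apply finv_tendsto hp _ (D' * (∫ x, ‖u x‖) + (1 + D) * ∫ x, ‖deriv u x‖)
  · have := tendsto_integral_of_dominated_convergence (μ := (volume : Measure ℝ)) (F := fun (n:ℕ) x => ‖(u - M (fun x : ℝ => B (((n:ℝ)+1)⁻¹ * (x - 0))) u) x‖)
      (f := fun _ => (0:ℝ)) (fun x => (1 + D) * ‖u x‖) (fun n => (SchwartzMap.integrable _).norm.aestronglyMeasurable)
      (u.integrable.norm.const_mul _) (fun n => Eventually.of_forall fun x => ?_) (Eventually.of_forall fun x => ?_)
    · simpa using this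
    · rw [norm_norm, sub_apply, M_apply (cut_temp B _ 0)]
      refine (norm_sub_le _ _).trans ?_
      rw [norm_mul, add_mul, one_mul]
      gcongr; exact hD _
    · refine tendsto_const_nhds.congr' ?_
      filter_upwards [eventually_ge_atTop ⌈|x|⌉₊] with n hn
      rw [sub_apply, M_apply (cut_temp B _ 0), hB]
      · simp
      · have h1 : |x| ≤ n := (Nat.le_ceil _).trans (by exact_mod_cast hn)
        rw [sub_zero, abs_mul, abs_of_pos (by positivity), inv_mul_le_iff₀ (by positivity)]
        linarith
  · intro n
    have hn : (0:ℝ) < ((n:ℝ) + 1)⁻¹ := by positivity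
    have hn1 : ((n:ℝ) + 1)⁻¹ ≤ 1 := inv_le_one_of_one_le₀ (by linarith [Nat.cast_nonneg (α := ℝ) n])
    rw [← integral_const_mul, ← integral_const_mul,
      ← integral_add (u.integrable.norm.const_mul _) ((deriv_integrable u).const_mul _)]
    refine integral_mono (deriv_integrable _) ((u.integrable.norm.const_mul _).add ((deriv_integrable u).const_mul _)) fun x => ?_
    have e : deriv (u - M (fun x : ℝ => B (((n:ℝ)+1)⁻¹ * (x - 0))) u : E) x = deriv u x -
        deriv (M (fun x : ℝ => B (((n:ℝ)+1)⁻¹ * (x - 0))) u) x := by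
      have := deriv_sub (u.differentiable x) ((M (fun x : ℝ => B (((n:ℝ)+1)⁻¹ * (x - 0))) u).differentiable x)
      rw [← this]; rfl
    simp only [e, cut_deriv]
    have h1 : ‖(((n:ℝ)+1)⁻¹ : ℝ) * deriv B (((n:ℝ)+1)⁻¹ * (x - 0)) * u x‖ ≤ D' * ‖u x‖ := by
      rw [norm_mul, norm_mul, Complex.norm_real, Real.norm_of_nonneg hn.le]
      gcongr
      calc _ ≤ 1 * D' := by gcongr; exact hD' _
        _ = D' := one_mul _
    have h2 : ‖B (((n:ℝ)+1)⁻¹ * (x - 0)) * deriv u x‖ ≤ D * ‖deriv u x‖ := by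
      rw [norm_mul]; gcongr; exact hD _
    refine (norm_sub_le _ _).trans ?_
    have h3 := norm_add_le ((((n:ℝ)+1)⁻¹ : ℝ) * deriv B (((n:ℝ)+1)⁻¹ * (x - 0)) * u x) (B (((n:ℝ)+1)⁻¹ * (x - 0)) * deriv u x)
    linarith

end FLC
end

section
open Filter Topology
open scoped FourierTransform ComplexOrder ContDiff
namespace FLC

theorem div_step {P : ℝ≥0∞} [Fact (1 ≤ P)] (hP : P ≠ ⊤) (g : E) (l : Lp ℂ P (volume : Measure ℝ) →L[ℂ] ℂ)
    (hl : ∀ s, l (SchwartzMap.toLp (T s g) P volume) = 0) (u : E) (hu : HasCompactSupport u)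
    (hO : ∀ x ∈ tsupport u, (𝓕 g : E) x ≠ 0) : l (SchwartzMap.toLp (𝓕⁻ u : E) P volume) = 0 := by
  have hc : HasCompactSupport (fun x => u x * ((𝓕 g : E) x)⁻¹) := hu.mul_right
  have hs : ContDiff ℝ ∞ (fun x => u x * ((𝓕 g : E) x)⁻¹) := by
    rw [contDiff_iff_contDiffAt]
    intro x
    by_cases hx : x ∈ tsupport u
    · exact (u.smooth ⊤).contDiffAt.mul (((𝓕 g : E).smooth ⊤).contDiffAt.inv (hO x hx))
    · have h0 : (fun x => u x * ((𝓕 g : E) x)⁻¹) =ᶠ[𝓝 x] fun _ => 0 := by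
        filter_upwards [notMem_tsupport_iff_eventuallyEq.1 hx] with y hy
        simp [hy]
      exact contDiffAt_const.congr_of_eventuallyEq h0
  set ψ : E := hc.toSchwartzMap hs with hψ
  have h1 := conv_eq hP g (𝓕⁻ ψ : E) l hl
  have h2 : SchwartzMap.convolution (ContinuousLinearMap.mul ℂ ℂ) (𝓕⁻ ψ : E) g = (𝓕⁻ u : E) := by
    have h3 : (𝓕 (SchwartzMap.convolution (ContinuousLinearMap.mul ℂ ℂ) (𝓕⁻ ψ : E) g) : E) = u := by
      rw [SchwartzMap.fourier_convolution]
      ext x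
      rw [SchwartzMap.pairing_apply_apply, FourierTransform.fourier_fourierInv_eq]
      show u x * ((𝓕 g : E) x)⁻¹ * (𝓕 g : E) x = u x
      by_cases hx : x ∈ tsupport u
      · rw [mul_assoc, inv_mul_cancel₀ (hO x hx), mul_one]
      · rw [image_eq_zero_of_notMem_tsupport hx]; simp
    rw [← h3, FourierTransform.fourierInv_fourier_eq]
  rwa [h2] at h1

variable {p : ℝ}

theorem finite_step (hp : 1 < p) [Fact (1 ≤ ENNReal.ofReal p)] (g : E)
    (l : Lp ℂ (ENNReal.ofReal p) (volume : Measure ℝ) →L[ℂ] ℂ)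
    (hl : ∀ s, l (SchwartzMap.toLp (T s g) (ENNReal.ofReal p) volume) = 0) (S : Finset ℝ) :
    ∀ u : E, HasCompactSupport u → (∀ x ∈ tsupport u, (𝓕 g : E) x ≠ 0 ∨ x ∈ S) →
      l (SchwartzMap.toLp (𝓕⁻ u : E) (ENNReal.ofReal p) volume) = 0 := by
  induction S using Finset.induction_on with
  | empty =>
    intro u hu hO
    exact div_step ENNReal.ofReal_ne_top g l hl u hu (by simpa using hO)
  | insert z S hz ih =>
    intro u hu hO
    obtain ⟨B, hB, -⟩ := exists_cut
    have h1 := (l.continuous.tendsto 0).comp (point_small hp B u z)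
    rw [map_zero] at h1
    refine tendsto_nhds_unique (tendsto_const_nhds.congr fun n => ?_) h1
    have hn : (0:ℝ) < (n:ℝ) + 1 := by positivity
    set m : E := M (fun x : ℝ => B (((n:ℝ)+1) * (x - z))) u with hm
    have hm' : ∀ x, m x = B (((n:ℝ)+1) * (x - z)) * u x := fun x => M_apply (cut_temp B _ z) u x
    have hv : ((u - m : E) : ℝ → ℂ) = fun x => (1 - B (((n:ℝ)+1) * (x - z))) * u x := by
      funext x; rw [sub_apply, hm']; ring
    have hsub : tsupport (u - m : E) ⊆ tsupport u := by
      rw [hv]; exact tsupport_mul_subset_right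
    have hzz : z ∉ tsupport (u - m : E) := by
      rw [notMem_tsupport_iff_eventuallyEq, hv]
      filter_upwards [Metric.ball_mem_nhds z (inv_pos.2 hn)] with x hx
      rw [Metric.mem_ball, Real.dist_eq] at hx
      rw [hB]
      · simp
      · rw [abs_mul, abs_of_pos hn]
        have := mul_le_mul_of_nonneg_left hx.le hn.le
        rwa [mul_inv_cancel₀ hn.ne'] at this
    have h2 := ih (u - m) (hu.of_isClosed_subset (isClosed_tsupport _) hsub) (by
      intro x hx
      rcases hO x (hsub hx) with h | h
      · exact Or.inl h
      · rw [Finset.mem_insert] at h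
        rcases h with rfl | h
        · exact absurd hx hzz
        · exact Or.inr h)
    have h3 : SchwartzMap.toLp (𝓕⁻ (u - m) : E) (ENNReal.ofReal p) volume =
        SchwartzMap.toLp (𝓕⁻ u : E) (ENNReal.ofReal p) volume - SchwartzMap.toLp (𝓕⁻ m : E) (ENNReal.ofReal p) volume := by
      have := map_sub (SchwartzMap.toLpCLM ℂ ℂ (ENNReal.ofReal p) volume ∘L FourierTransform.fourierInvCLM ℂ E) u m
      exact this
    rw [h3, map_sub, sub_eq_zero] at h2
    exact h2

theorem zeros_finite (a : ℝ) (ha : 0 < a) (K : Set ℝ) (hK : IsCompact K) :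
    ∃ S : Finset ℝ, ∀ x ∈ K, Real.cos (2 * Real.pi * a * x) = -1 → x ∈ S := by
  obtain ⟨R, hR⟩ := hK.isBounded.exists_norm_le
  refine ⟨(Finset.Icc (-⌈a * R + 1⌉) ⌈a * R + 1⌉).image fun k : ℤ => (1/2 + (k:ℝ)) / a, fun x hx hc => ?_⟩
  obtain ⟨k, hk⟩ := Real.cos_eq_neg_one_iff.1 hc
  have h1 : 1/2 + (k:ℝ) = a * x := by
    have := Real.pi_pos
    have h : 2 * Real.pi * (1/2 + (k:ℝ)) = 2 * Real.pi * (a * x) := by linarith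
    exact mul_left_cancel₀ (by positivity) h
  have h2 := abs_le.1 (hR x hx)
  have h3 := Int.le_ceil (a * R + 1)
  rw [Finset.mem_image]
  refine ⟨k, ?_, by rw [h1]; field_simp⟩
  have h4 : a * x ≤ a * R := by gcongr; exact h2.2
  have h5 : -(a * R) ≤ a * x := by have := mul_le_mul_of_nonneg_left h2.1 ha.le; linarith
  rw [Finset.mem_Icc]
  constructor
  · have : -((⌈a * R + 1⌉ : ℤ) : ℝ) ≤ (k:ℝ) := by linarith
    exact_mod_cast this
  · have : (k:ℝ) ≤ ((⌈a * R + 1⌉ : ℤ) : ℝ) := by linarith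
    exact_mod_cast this

theorem all_zero (hp : 1 < p) [Fact (1 ≤ ENNReal.ofReal p)] (a : ℝ) (ha : 0 < a) (g : E)
    (hg : ∀ x, Real.cos (2*Real.pi*a*x) ≠ -1 → (𝓕 g : E) x ≠ 0)
    (l : Lp ℂ (ENNReal.ofReal p) (volume : Measure ℝ) →L[ℂ] ℂ)
    (hl : ∀ s, l (SchwartzMap.toLp (T s g) (ENNReal.ofReal p) volume) = 0) : l = 0 := by
  have hc : ∀ u : E, HasCompactSupport u → l (SchwartzMap.toLp (𝓕⁻ u : E) (ENNReal.ofReal p) volume) = 0 := by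
    intro u hu
    obtain ⟨S, hS⟩ := zeros_finite a ha _ hu
    refine finite_step hp g l hl S u hu fun x hx => ?_
    by_cases h : Real.cos (2*Real.pi*a*x) = -1
    · exact Or.inr (hS x hx h)
    · exact Or.inl (hg x h)
  have hall : ∀ u : E, l (SchwartzMap.toLp (𝓕⁻ u : E) (ENNReal.ofReal p) volume) = 0 := by
    intro u
    obtain ⟨B, hB, hBc⟩ := exists_cut
    have h1 := (l.continuous.tendsto 0).comp (infty_small hp B u hB)
    rw [map_zero] at h1
    refine tendsto_nhds_unique (tendsto_const_nhds.congr fun n => ?_) h1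
    have hn : (0:ℝ) < ((n:ℝ) + 1)⁻¹ := by positivity
    set m : E := M (fun x : ℝ => B (((n:ℝ)+1)⁻¹ * (x - 0))) u with hm
    have hm' : (m : ℝ → ℂ) = fun x => B (((n:ℝ)+1)⁻¹ * (x - 0)) * u x := by
      funext x; exact M_apply (cut_temp B _ 0) u x
    have hmc : HasCompactSupport m := by
      rw [hm']
      have h5 := hBc.comp_homeomorph (Homeomorph.mulLeft₀ ((n:ℝ)+1)⁻¹ hn.ne')
      have h6 : (fun x : ℝ => B (((n:ℝ)+1)⁻¹ * (x - 0))) =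
          B ∘ (Homeomorph.mulLeft₀ ((n:ℝ)+1)⁻¹ hn.ne') := by
        funext x; simp
      have h7 : HasCompactSupport (fun x : ℝ => B (((n:ℝ)+1)⁻¹ * (x - 0))) := by rw [h6]; exact h5
      exact h7.mul_right
    have h3 : SchwartzMap.toLp (𝓕⁻ (u - m) : E) (ENNReal.ofReal p) volume =
        SchwartzMap.toLp (𝓕⁻ u : E) (ENNReal.ofReal p) volume - SchwartzMap.toLp (𝓕⁻ m : E) (ENNReal.ofReal p) volume := by
      have := map_sub (SchwartzMap.toLpCLM ℂ ℂ (ENNReal.ofReal p) volume ∘L FourierTransform.fourierInvCLM ℂ E) u m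
      exact this
    simp only [Function.comp]
    rw [h3, map_sub, hc m hmc, sub_zero]
  have hd := SchwartzMap.denseRange_toLpCLM (E := ℝ) (F := ℂ) (p := ENNReal.ofReal p) (μ := (volume : Measure ℝ)) ENNReal.ofReal_ne_top
  have h0 : (l : Lp ℂ (ENNReal.ofReal p) (volume : Measure ℝ) → ℂ) = fun _ => 0 := by
    refine hd.equalizer l.continuous continuous_const ?_
    funext f
    have := hall (𝓕 f)
    rw [FourierTransform.fourierInv_fourier_eq] at this
    exact this
  ext f
  exact congrFun h0 f

theorem final (hp : 1 < p) [Fact (1 ≤ ENNReal.ofReal p)] (a : ℝ) (ha : 0 < a) (g : E)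
    (hg : ∀ x, Real.cos (2*Real.pi*a*x) ≠ -1 → (𝓕 g : E) x ≠ 0) (lam : ℕ → ℝ)
    (hlam : ∀ (k:ℕ) (r:ℚ), ∃ s:ℝ, |s - r| < 1/((k:ℝ)+1) ∧
      ∃ y ∈ Submodule.span ℂ {f | ∃ n:ℕ, 1 ≤ n ∧ f = T (lam n) g}, q k (T s g - y) < 1/((k:ℝ)+1))
    (X : Submodule ℂ (Lp ℂ (ENNReal.ofReal p) (volume : Measure ℝ)))
    (hX : ∀ n, 1 ≤ n → SchwartzMap.toLp (T (lam n) g) (ENNReal.ofReal p) volume ∈ X) :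
    Dense (X : Set (Lp ℂ (ENNReal.ofReal p) (volume : Measure ℝ))) := by
  rw [Submodule.dense_iff_topologicalClosure_eq_top]
  by_contra hne
  obtain ⟨x, hx⟩ : ∃ x, x ∉ X.topologicalClosure := by
    by_contra! h
    exact hne (eq_top_iff.2 fun x _ => h x)
  have hcl : IsClosed (X.topologicalClosure : Set (Lp ℂ (ENNReal.ofReal p) (volume : Measure ℝ))) :=
    X.isClosed_topologicalClosure
  set mk := X.topologicalClosure.mkQL with hmk
  have hmx : mk x ≠ 0 := by
    intro h
    exact hx ((Submodule.Quotient.mk_eq_zero _).1 h)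
  obtain ⟨f, -, hf⟩ := exists_dual_vector ℂ (mk x) (norm_ne_zero_iff.2 hmx)
  set l : Lp ℂ (ENNReal.ofReal p) (volume : Measure ℝ) →L[ℂ] ℂ := f ∘L mk with hl
  have hlX : ∀ y ∈ X, l y = 0 := by
    intro y hy
    have : mk y = 0 := (Submodule.Quotient.mk_eq_zero _).2 (X.le_topologicalClosure hy)
    simp [hl, this]
  set L : E →L[ℂ] ℂ := l ∘L SchwartzMap.toLpCLM ℂ ℂ (ENNReal.ofReal p) volume with hL
  have hLs : ∀ y ∈ Submodule.span ℂ {f | ∃ n:ℕ, 1 ≤ n ∧ f = T (lam n) g}, L y = 0 := by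
    intro y hy
    have : Submodule.span ℂ {f | ∃ n:ℕ, 1 ≤ n ∧ f = T (lam n) g} ≤ L.ker := by
      rw [Submodule.span_le]
      rintro _ ⟨n, hn, rfl⟩
      exact hlX _ (hX n hn)
    exact this hy
  have hFc : Continuous fun s : ℝ => L (T s g) := l.continuous.comp (tau_cont ENNReal.ofReal_ne_top g)
  have hrat : ∀ r : ℚ, L (T r g) = 0 := by
    intro r
    choose s hs y hy hq using fun k => hlam k r
    have l1 : Tendsto s atTop (𝓝 (r:ℝ)) := by
      rw [tendsto_iff_dist_tendsto_zero]
      exact squeeze_zero (fun _ => dist_nonneg) (fun k => (hs k).le) tendsto_one_div_add_atTop_nhds_zero_nat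
    have l2 := (hFc.tendsto (r:ℝ)).comp l1
    have l3 : Tendsto (fun k => L (T (s k) g)) atTop (𝓝 0) := by
      rw [tendsto_def]
      intro U hU
      have hU' : L ⁻¹' U ∈ 𝓝 (0:E) := L.continuous.continuousAt.preimage_mem_nhds (by simpa using hU)
      obtain ⟨k0, hk0⟩ := q_basis 0 _ hU'
      filter_upwards [eventually_ge_atTop k0] with k hk
      have := hk0 k hk (T (s k) g - y k) (by
        rw [zero_sub, map_neg_eq_map]; exact hq k)
      rw [Set.mem_preimage, map_sub, hLs _ (hy k), sub_zero] at this
      exact this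
    exact tendsto_nhds_unique l2 l3
  have hF : (fun s : ℝ => L (T s g)) = fun _ => 0 := by
    refine (Rat.denseRange_cast (𝕜 := ℝ)).equalizer hFc continuous_const ?_
    funext r; exact hrat r
  have hl0 : l = 0 := all_zero hp a ha g hg l fun s => congrFun hF s
  have : l x = 0 := by rw [hl0]; rfl
  have h2 : l x = (‖mk x‖ : ℂ) := hf
  rw [h2] at this
  exact hmx (norm_eq_zero.1 (by exact_mod_cast this))

end FLC
end

/-- **Finite local complexity sequences of translates.**
Let `a, b > 0` be linearly independent over `ℚ`. Then there exist a real sequence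
`(lam n)_{n ≥ 1}` whose successive differences `lam (n+1) - lam n` all lie in `{a, b}`,
and a nonnegative Schwartz function `g`, such that for every `p > 1` the system of
translates `{x ↦ g (x - lam n)}_{n ≥ 1}` is complete in `L^p(ℝ)`. -/
theorem finite_local_complexity_complete_translates
    (a b : ℝ) (ha : 0 < a) (hb : 0 < b)
    (hab : LinearIndependent ℚ ![a, b]) :
    ∃ (lam : ℕ → ℝ) (g : SchwartzMap ℝ ℝ),
      (∀ n : ℕ, 1 ≤ n → lam (n + 1) - lam n ∈ ({a, b} : Set ℝ)) ∧
      (∀ x, 0 ≤ g x) ∧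
      (∀ p : ℝ, (hp : 1 < p) →
        @TranslatesComplete (⇑g) lam (ENNReal.ofReal p)
          ⟨ENNReal.one_le_ofReal.mpr hp.le⟩) := by
  obtain ⟨gc, hg0, hg1, hg2⟩ := FLC.exists_g a
  obtain ⟨lam, hl1, hl2⟩ := FLC.exists_lam a b ha hab gc hg2
  have hre : ∀ x, ((gc x).re : ℂ) = gc x := by
    intro x
    have h := (Complex.le_def.1 (hg0 x)).2
    apply Complex.ext
    · simp
    · simpa using h
  let g : SchwartzMap ℝ ℝ := SchwartzMap.postcompCLM Complex.reCLM gc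
  have hg : ∀ x, g x = (gc x).re := fun x => rfl
  refine ⟨lam, g, fun n _ => hl1 n, fun x => ?_, fun p hp => ?_⟩
  · rw [hg]
    exact (Complex.le_def.1 (hg0 x)).1
  · have : Fact (1 ≤ ENNReal.ofReal p) := ⟨ENNReal.one_le_ofReal.mpr hp.le⟩
    unfold TranslatesComplete
    refine FLC.final hp a ha gc hg1 lam hl2 _ fun n hn => Submodule.subset_span ⟨n, hn, ?_⟩
    refine (SchwartzMap.coeFn_toLp _ _ _).trans (Filter.Eventually.of_forall fun x => ?_)
    show _ = ((g (x - lam n) : ℝ) : ℂ)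
    rw [hg, hre]
    simp [FLC.T]
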